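/- arXiv:2512.11765 — 2 statements merged into one kernel-verified Lean document; each statement's English description precedes it below -/
import Mathlib

section
/- Let n ≥ 2 be an integer, ρ > 0, T > 0, θ > 0, and x_1,…,x_n ∈ ℝ with mean x̄. For each N ≥ 2 let ξ^{(N)}_i := x̄·v^{(N)} + (x_i − x̄)·w^{(N)} be the equilibrium strategy on the equidistant N-step grid, C_N(i) := (1/2)·(ξ^{(N)}_i)^⊤ Γ^θ ξ^{(N)}_i + (ξ^{(N)}_i)^⊤ Γ̃ (Σ_{j≠i} ξ^{(N)}_j), and let the discrete impact cost be 𝓘_N(i) := C_N(i) − θ·Σ_{k=1}^{N+1} (ξ^{(N)}_{i,k})². Then for each i, 𝓘_N(i) → 𝓘 as N → ∞, where, with E := e^{ρT(n+1)/(n−1)} and D := n((ρT+1)(n+1)+2)·E − (n−1): 𝓘 := (n/(ρT+1))·x̄(x_i−x̄) + x̄²·n³(n+1)·[ ((ρT+1/2)(n+1)+3)·E² − (2(n−1)/n²)·(n·E + 1/4) ]/D². -/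
open Matrix Finset Filter

noncomputable section

/-- The matrix `Γ^θ`. -/
def Gam (ρ θ : ℝ) {N : ℕ} (t : Fin (N + 1) → ℝ) : Matrix (Fin (N + 1)) (Fin (N + 1)) ℝ :=
  Matrix.of (fun i j => Real.exp (-(ρ * |t i - t j|)) + (if i = j then 2 * θ else 0))

/-- The matrix `Γ̃`. -/
def GamT (ρ : ℝ) {N : ℕ} (t : Fin (N + 1) → ℝ) : Matrix (Fin (N + 1)) (Fin (N + 1)) ℝ :=
  Matrix.of (fun i j =>
    if i < j then 0 else if i = j then 1 / 2 else Real.exp (-(ρ * (t i - t j))))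

/-- The equidistant grid `t_k = kT/N`. -/
def egrid (T : ℝ) (N : ℕ) : Fin (N + 1) → ℝ := fun k => (k.val : ℝ) * T / (N : ℝ)

/-- `ν^{(N)} := (Γ^θ + (n−1)Γ̃)^{−1} 1` on the equidistant `N`-step grid. -/
def nuN (n N : ℕ) (ρ T θ : ℝ) : Fin (N + 1) → ℝ :=
  (Gam ρ θ (egrid T N) + ((n : ℝ) - 1) • GamT ρ (egrid T N))⁻¹.mulVec 1

/-- `ω^{(N)} := (Γ^θ − Γ̃)^{−1} 1` on the equidistant `N`-step grid. -/
def omN (N : ℕ) (ρ T θ : ℝ) : Fin (N + 1) → ℝ :=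
  (Gam ρ θ (egrid T N) - GamT ρ (egrid T N))⁻¹.mulVec 1

/-- `v^{(N)} := ν^{(N)} / (1^⊤ν^{(N)})`. -/
def vN (n N : ℕ) (ρ T θ : ℝ) : Fin (N + 1) → ℝ :=
  (1 / ∑ k, nuN n N ρ T θ k) • nuN n N ρ T θ

/-- `w^{(N)} := ω^{(N)} / (1^⊤ω^{(N)})`. -/
def wN (N : ℕ) (ρ T θ : ℝ) : Fin (N + 1) → ℝ :=
  (1 / ∑ k, omN N ρ T θ k) • omN N ρ T θ

/-- `V^{(N)}_t = 1 − Σ_{k=1}^{⌈Nt/T⌉} v_k` (paper index `k` is Lean index `k.val + 1`). -/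
def VN (n N : ℕ) (ρ T θ : ℝ) (t : ℝ) : ℝ :=
  1 - ∑ k : Fin (N + 1), (if k.val < ⌈(N : ℝ) * t / T⌉₊ then vN n N ρ T θ k else 0)

/-- `W^{(N)}_t = 1 − Σ_{k=1}^{⌈Nt/T⌉} w_k` (paper index `k` is Lean index `k.val + 1`). -/
def WN (N : ℕ) (ρ T θ : ℝ) (t : ℝ) : ℝ :=
  1 - ∑ k : Fin (N + 1), (if k.val < ⌈(N : ℝ) * t / T⌉₊ then wN N ρ T θ k else 0)

/-- Equilibrium strategy `ξ^{(N)}_i = x̄ v^{(N)} + (x_i − x̄) w^{(N)}`. -/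
def xiN (n N : ℕ) (ρ T θ : ℝ) (x : Fin n → ℝ) (i : Fin n) : Fin (N + 1) → ℝ :=
  ((∑ j, x j) / (n : ℝ)) • vN n N ρ T θ + (x i - (∑ j, x j) / (n : ℝ)) • wN N ρ T θ

/-- Equilibrium execution cost of agent `i` on the `N`-step grid:
`C_N(i) = (1/2) ξ_i^⊤ Γ^θ ξ_i + ξ_i^⊤ Γ̃ (Σ_{j≠i} ξ_j)`. -/
def costN (n N : ℕ) (ρ T θ : ℝ) (x : Fin n → ℝ) (i : Fin n) : ℝ :=
  (1 / 2) * (xiN n N ρ T θ x i ⬝ᵥ (Gam ρ θ (egrid T N)).mulVec (xiN n N ρ T θ x i))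
    + xiN n N ρ T θ x i ⬝ᵥ
        (GamT ρ (egrid T N)).mulVec (∑ j ∈ Finset.univ.erase i, xiN n N ρ T θ x j)


def LL (a : ℝ) (N : ℕ) : Matrix (Fin (N + 1)) (Fin (N + 1)) ℝ :=
  Matrix.of (fun i j => if i < j then 0 else if i = j then 1 / 2 else a ^ (i.val - j.val))

def AA (p θ a : ℝ) (N : ℕ) : Matrix (Fin (N + 1)) (Fin (N + 1)) ℝ :=
  (LL a N)ᵀ + p • LL a N + (2 * θ) • 1

lemma GamT_eq (ρ T : ℝ) (N : ℕ) :
    GamT ρ (egrid T N) = LL (Real.exp (-(ρ * T) / N)) N := by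
  ext i j
  simp only [GamT, LL, egrid, Matrix.of_apply]
  split_ifs with h1 h2
  · rfl
  · rfl
  · rw [← Real.exp_nat_mul]
    have : j.val ≤ i.val := by
      have := not_lt.mp h1
      exact_mod_cast this
    rw [Nat.cast_sub this]
    congr 1
    ring

lemma Gam_eq (ρ T θ : ℝ) (hT : 0 < T) (N : ℕ) :
    Gam ρ θ (egrid T N) =
      LL (Real.exp (-(ρ * T) / N)) N + (LL (Real.exp (-(ρ * T) / N)) N)ᵀ + (2 * θ) • 1 := by
  rw [← GamT_eq]
  ext i j
  have key : ∀ i j : Fin (N+1), i < j → egrid T N i ≤ egrid T N j := by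
    intro i j h
    have : (i.val : ℝ) ≤ j.val := by exact_mod_cast h.le
    simp only [egrid]
    gcongr
  rcases lt_trichotomy i j with h | h | h
  · have := key _ _ h
    simp [Gam, GamT, h, h.ne, h.ne', not_lt.mpr h.le, abs_of_nonpos (sub_nonpos.mpr this)]
  · subst h
    simp [Gam, GamT]
    norm_num
  · have := key _ _ h
    simp [Gam, GamT, h, h.ne', not_lt.mpr h.le, abs_of_nonneg (sub_nonneg.mpr this)]

lemma LL_aux (a : ℝ) (ha : 0 ≤ a) (ha1 : a ≤ 1) (f : ℕ → ℝ) (m : ℕ) :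
    (∑ j ∈ range (m + 1), a ^ (m - j) * f j) ^ 2 / 2 ≤
      ∑ i ∈ range (m + 1), f i * (∑ j ∈ range i, a ^ (i - j) * f j + f i / 2) := by
  induction m with
  | zero => simp; nlinarith
  | succ m ih =>
    rw [sum_range_succ (fun i => f i * _) (m+1), sum_range_succ _ (m+1)]
    have : ∑ j ∈ range (m + 1), a ^ (m + 1 - j) * f j =
        a * ∑ j ∈ range (m + 1), a ^ (m - j) * f j := by
      rw [mul_sum]
      apply sum_congr rfl
      intro j hj
      have : m + 1 - j = (m - j) + 1 := by
        have := mem_range.mp hj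
        omega
      rw [this]; ring
    rw [this]
    set F := ∑ j ∈ range (m + 1), a ^ (m - j) * f j
    have h2 : (a * F) ^ 2 ≤ F ^ 2 := by
      rw [mul_pow]
      have : a ^ 2 ≤ 1 := by nlinarith
      nlinarith [sq_nonneg F]
    simp only [Nat.sub_self, pow_zero]
    nlinarith

lemma low_sum (a : ℝ) (f : ℕ → ℝ) (N i : ℕ) (hi : i ≤ N) :
    ∑ j ∈ range (N + 1), (if i < j then 0 else if i = j then 1 / 2 else a ^ (i - j)) * f j
      = ∑ j ∈ range i, a ^ (i - j) * f j + f i / 2 := by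
  induction N, hi using Nat.le_induction with
  | base =>
    rw [sum_range_succ]
    congr 1
    · apply sum_congr rfl
      intro j hj
      have := mem_range.mp hj
      simp [not_lt.mpr this.le, this.ne']
    · simp; ring
  | succ m hm ih =>
    rw [sum_range_succ, ih]
    simp [Nat.lt_succ_of_le hm]

lemma LL_mulVec (a : ℝ) (N : ℕ) (f : ℕ → ℝ) (i : Fin (N + 1)) :
    (LL a N *ᵥ (fun j => f j.val)) i =
      ∑ j ∈ range i.val, a ^ (i.val - j) * f j + f i.val / 2 := by
  rw [← low_sum a f N i (Nat.lt_succ_iff.mp i.2), ← Fin.sum_univ_eq_sum_range]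
  simp only [Matrix.mulVec, dotProduct, LL, Matrix.of_apply, Fin.lt_def, Fin.ext_iff]

lemma LL_nonneg (a : ℝ) (ha : 0 ≤ a) (ha1 : a ≤ 1) (N : ℕ) (x : Fin (N + 1) → ℝ) :
    0 ≤ x ⬝ᵥ LL a N *ᵥ x := by
  obtain ⟨f, rfl⟩ : ∃ f : ℕ → ℝ, x = fun j => f j.val :=
    ⟨fun j => if h : j < N + 1 then x ⟨j, h⟩ else 0, by ext j; simp; intro h; omega⟩
  simp only [dotProduct, LL_mulVec]
  rw [Fin.sum_univ_eq_sum_range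
    (fun i => f i * (∑ j ∈ range i, a ^ (i - j) * f j + f i / 2))]
  exact le_trans (by positivity) (LL_aux a ha ha1 f N)

lemma AA_quad (p θ a : ℝ) (N : ℕ) (x : Fin (N + 1) → ℝ) :
    x ⬝ᵥ AA p θ a N *ᵥ x = (p + 1) * (x ⬝ᵥ LL a N *ᵥ x) + 2 * θ * (x ⬝ᵥ x) := by
  have : x ⬝ᵥ (LL a N)ᵀ *ᵥ x = x ⬝ᵥ LL a N *ᵥ x := by
    rw [Matrix.mulVec_transpose, dotProduct_comm, ← Matrix.dotProduct_mulVec]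
  simp only [AA, Matrix.add_mulVec, dotProduct_add, this, Matrix.smul_mulVec, dotProduct_smul,
    Matrix.one_mulVec, smul_eq_mul]
  ring

lemma AA_coer (p θ a : ℝ) (hp : 0 ≤ p) (ha : 0 ≤ a) (ha1 : a ≤ 1) (N : ℕ)
    (x : Fin (N + 1) → ℝ) : 2 * θ * (x ⬝ᵥ x) ≤ x ⬝ᵥ AA p θ a N *ᵥ x := by
  rw [AA_quad]
  have := mul_nonneg (by linarith : 0 ≤ p + 1) (LL_nonneg a ha ha1 N x)
  linarith

lemma AA_unit (p θ a : ℝ) (hp : 0 ≤ p) (hθ : 0 < θ) (ha : 0 ≤ a) (ha1 : a ≤ 1) (N : ℕ) :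
    IsUnit (AA p θ a N).det := by
  rw [← Matrix.isUnit_iff_isUnit_det, ← Matrix.mulVec_injective_iff_isUnit]
  intro x y h
  have h0 : AA p θ a N *ᵥ (x - y) = 0 := by
    rw [Matrix.mulVec_sub]; exact sub_eq_zero.mpr h
  have h1 := AA_coer p θ a hp ha ha1 N (x - y)
  rw [h0, dotProduct_zero] at h1
  have h2 : (x - y) ⬝ᵥ (x - y) = 0 := by
    have h3 : 0 ≤ (x - y) ⬝ᵥ (x - y) := Finset.sum_nonneg fun i _ => mul_self_nonneg _
    nlinarith
  exact sub_eq_zero.mp (dotProduct_self_eq_zero.mp h2)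

lemma AA_inv (p θ a : ℝ) (hp : 0 ≤ p) (hθ : 0 < θ) (ha : 0 ≤ a) (ha1 : a ≤ 1) (N : ℕ) :
    AA p θ a N *ᵥ ((AA p θ a N)⁻¹ *ᵥ 1) = 1 := by
  rw [Matrix.mulVec_mulVec, Matrix.mul_nonsing_inv _ (AA_unit p θ a hp hθ ha ha1 N),
    Matrix.one_mulVec]

lemma AA_uniq (p θ a : ℝ) (hp : 0 ≤ p) (hθ : 0 < θ) (ha : 0 ≤ a) (ha1 : a ≤ 1) (N : ℕ)
    (x : Fin (N + 1) → ℝ) (hx : AA p θ a N *ᵥ x = 1) : (AA p θ a N)⁻¹ *ᵥ 1 = x := by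
  rw [← hx, Matrix.mulVec_mulVec, Matrix.nonsing_inv_mul _ (AA_unit p θ a hp hθ ha ha1 N),
    Matrix.one_mulVec]

lemma low_geo (a z : ℝ) (hz : z - a ≠ 0) (i : ℕ) :
    ∑ j ∈ range i, a ^ (i - j) * z ^ j = a * (z ^ i - a ^ i) / (z - a) := by
  rw [eq_div_iff hz]
  induction i with
  | zero => simp
  | succ m ih =>
    rw [sum_range_succ]
    have : ∑ j ∈ range m, a ^ (m + 1 - j) * z ^ j = a * ∑ j ∈ range m, a ^ (m - j) * z ^ j := by
      rw [mul_sum]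
      apply sum_congr rfl
      intro j hj
      have : m + 1 - j = (m - j) + 1 := by
        have := mem_range.mp hj
        omega
      rw [this]; ring
    rw [this, add_mul, mul_assoc, ih]
    simp
    ring

lemma up_geo (a z : ℝ) (hz : 1 - a * z ≠ 0) (N i : ℕ) (hi : i ≤ N) :
    ∑ j ∈ range (N + 1), (if j < i then 0 else if j = i then 1 / 2 else a ^ (j - i)) * z ^ j
      = z ^ i / 2 + (a * z ^ (i + 1) - a ^ (N + 1 - i) * z ^ (N + 1)) / (1 - a * z) := by
  induction N, hi using Nat.le_induction with
  | base =>
    rw [sum_range_succ, sum_eq_zero]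
    · simp; ring
    · intro j hj
      simp [mem_range.mp hj]
  | succ m hm ih =>
    rw [sum_range_succ, ih]
    have h1 : ¬ (m + 1 < i) := by omega
    have h2 : ¬ (m + 1 = i) := by omega
    have h3 : m + 1 + 1 - i = (m + 1 - i) + 1 := by omega
    simp only [h1, h2, if_false, h3]
    field_simp
    ring

lemma LLT_geo (a z : ℝ) (hz : 1 - a * z ≠ 0) (N : ℕ) (i : Fin (N + 1)) :
    ((LL a N)ᵀ *ᵥ (fun j => z ^ j.val)) i = z ^ i.val / 2 +
      (a * z ^ (i.val + 1) - a ^ (N + 1 - i.val) * z ^ (N + 1)) / (1 - a * z) := by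
  rw [← up_geo a z hz N i (Nat.lt_succ_iff.mp i.2), ← Fin.sum_univ_eq_sum_range
    (fun j => (if j < i.val then 0 else if j = i.val then 1 / 2 else a ^ (j - i.val)) * z ^ j)]
  simp only [Matrix.mulVec, dotProduct, LL, Matrix.of_apply, Matrix.transpose_apply,
    Fin.lt_def, Fin.ext_iff]

lemma AA_geo (p θ a z : ℝ) (hz : z - a ≠ 0) (hz' : 1 - a * z ≠ 0) (N : ℕ) (i : Fin (N + 1)) :
    (AA p θ a N *ᵥ (fun j => z ^ j.val)) i =
      z ^ i.val * ((p + 1) / 2 + 2 * θ + p * a / (z - a) + a * z / (1 - a * z))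
      - p * a ^ (i.val + 1) / (z - a) - a ^ (N + 1 - i.val) * z ^ (N + 1) / (1 - a * z) := by
  simp only [AA, Matrix.add_mulVec, Pi.add_apply, LLT_geo a z hz', Matrix.smul_mulVec,
    Pi.smul_apply, LL_mulVec a N (fun j => z ^ j), low_geo a z hz, Matrix.one_mulVec, smul_eq_mul]
  field_simp
  ring

lemma AA_rev (p θ a : ℝ) (N : ℕ) (i j : Fin (N + 1)) :
    AA p θ a N (Fin.rev j) i = AA p θ a N (Fin.rev i) j := by
  have hl : ∀ i j : Fin (N+1), LL a N (Fin.rev j) i = LL a N (Fin.rev i) j := by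
    intro i j
    have h1 : (Fin.rev j < i) ↔ (Fin.rev i < j) := by
      simp only [Fin.lt_def, Fin.val_rev]; omega
    have h2 : (Fin.rev j = i) ↔ (Fin.rev i = j) := by
      simp only [Fin.ext_iff, Fin.val_rev]; omega
    have h3 : (Fin.rev j).val - i.val = (Fin.rev i).val - j.val := by
      simp only [Fin.val_rev]; omega
    simp only [LL, Matrix.of_apply, h1, h2, h3]
  have ht : ∀ i j : Fin (N+1), LL a N i (Fin.rev j) = LL a N j (Fin.rev i) := by
    intro i j
    have := hl (Fin.rev i) (Fin.rev j)
    simp only [Fin.rev_rev] at this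
    exact this.symm
  have h2 : (Fin.rev j = i) ↔ (Fin.rev i = j) := by
      simp only [Fin.ext_iff, Fin.val_rev]; omega
  simp only [AA, Matrix.add_apply, Matrix.smul_apply, Matrix.transpose_apply, hl i j, ht i j,
    Matrix.one_apply, h2]

/-- summing `e` against the reversed solution -/
lemma sum_eq_rev (p θ a : ℝ) (N : ℕ) (ν e : Fin (N + 1) → ℝ) (hν : AA p θ a N *ᵥ ν = 1) :
    ∑ i, e i = (fun i => ν (Fin.rev i)) ⬝ᵥ (AA p θ a N *ᵥ e) := by
  have h : (fun i => ν (Fin.rev i)) ᵥ* (AA p θ a N) = 1 := by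
    ext i
    have h1 := congrFun hν (Fin.rev i)
    rw [Pi.one_apply] at h1
    rw [Pi.one_apply, ← h1]
    simp only [Matrix.vecMul, Matrix.mulVec, dotProduct]
    rw [← Equiv.sum_comp Fin.revPerm]
    apply sum_congr rfl
    intro j _
    simp only [Fin.revPerm_apply, Fin.rev_rev, AA_rev p θ a N i j]
    ring
  rw [Matrix.dotProduct_mulVec, h]
  simp [dotProduct]

lemma dot_sq_le {N : ℕ} (x y : Fin (N + 1) → ℝ) :
    (x ⬝ᵥ y) ^ 2 ≤ (x ⬝ᵥ x) * (y ⬝ᵥ y) := by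
  have := Finset.sum_mul_sq_le_sq_mul_sq Finset.univ x y
  simpa only [dotProduct, pow_two] using this

lemma dot_self_nonneg {N : ℕ} (x : Fin (N + 1) → ℝ) : 0 ≤ x ⬝ᵥ x :=
  Finset.sum_nonneg fun _ _ => mul_self_nonneg _

lemma tendsto_zero_of_sq_le (f g : ℕ → ℝ) (h : ∀ᶠ N in atTop, f N ^ 2 ≤ g N)
    (hg : Tendsto g atTop (nhds 0)) : Tendsto f atTop (nhds 0) := by
  have h1 : Tendsto (fun N => f N ^ 2) atTop (nhds 0) :=
    squeeze_zero' (Eventually.of_forall fun N => sq_nonneg _) h hg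
  have h2 := h1.sqrt
  simp only [Real.sqrt_sq_eq_abs, Real.sqrt_zero] at h2
  exact (tendsto_zero_iff_abs_tendsto_zero f).mpr h2

lemma tendsto_dot_zero (x y : ∀ N : ℕ, Fin (N + 1) → ℝ) (X : ℝ)
    (hx : Tendsto (fun N => x N ⬝ᵥ x N) atTop (nhds X))
    (hy : Tendsto (fun N => y N ⬝ᵥ y N) atTop (nhds 0)) :
    Tendsto (fun N => x N ⬝ᵥ y N) atTop (nhds 0) := by
  apply tendsto_zero_of_sq_le _ _ (Eventually.of_forall fun N => dot_sq_le (x N) (y N))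
  simpa using hx.mul hy

lemma stab (p θ : ℝ) (hp : 0 ≤ p) (hθ : 0 < θ) (a : ℕ → ℝ) (ha : ∀ N, 0 ≤ a N)
    (ha1 : ∀ N, a N ≤ 1) (ν νh ε : ∀ N : ℕ, Fin (N + 1) → ℝ)
    (hν : ∀ N, AA p θ (a N) N *ᵥ ν N = 1)
    (hε : ∀ᶠ N in atTop, AA p θ (a N) N *ᵥ νh N = 1 + ε N)
    (m s : ℝ)
    (hεε : Tendsto (fun N => ε N ⬝ᵥ ε N) atTop (nhds 0))
    (hm : Tendsto (fun N => νh N ⬝ᵥ νh N) atTop (nhds m))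
    (hs : Tendsto (fun N => ∑ i, νh N i) atTop (nhds s)) :
    Tendsto (fun N => (νh N - ν N) ⬝ᵥ (νh N - ν N)) atTop (nhds 0) ∧
    Tendsto (fun N => ν N ⬝ᵥ ν N) atTop (nhds m) ∧
    Tendsto (fun N => ∑ i, ν N i) atTop (nhds s) := by
  have hAe : ∀ᶠ N in atTop, AA p θ (a N) N *ᵥ (νh N - ν N) = ε N := by
    filter_upwards [hε] with N h
    rw [Matrix.mulVec_sub, h, hν]; simp
  have hee : Tendsto (fun N => (νh N - ν N) ⬝ᵥ (νh N - ν N)) atTop (nhds 0) := by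
    have h0 : Tendsto (fun N => (ε N ⬝ᵥ ε N) / (2 * θ) ^ 2) atTop (nhds 0) := by
      simpa using hεε.div_const ((2 * θ) ^ 2)
    refine squeeze_zero' (Eventually.of_forall fun N => dot_self_nonneg _) ?_ h0
    filter_upwards [hAe] with N h
    have h1 := AA_coer p θ (a N) hp (ha N) (ha1 N) N (νh N - ν N)
    rw [h] at h1
    have h2 := dot_sq_le (νh N - ν N) (ε N)
    have h3 := dot_self_nonneg (νh N - ν N)
    set q := (νh N - ν N) ⬝ᵥ (νh N - ν N)
    rw [le_div_iff₀ (by positivity)]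
    rcases h3.eq_or_lt with h4 | h4
    · rw [← h4]; simpa using dot_self_nonneg (ε N)
    · have h5 : (2 * θ * q) ^ 2 ≤ q * (ε N ⬝ᵥ ε N) :=
        le_trans (by gcongr) h2
      have : q * (q * (2 * θ) ^ 2) ≤ q * (ε N ⬝ᵥ ε N) := by linarith
      exact le_of_mul_le_mul_left this h4
  have hνν : Tendsto (fun N => ν N ⬝ᵥ ν N) atTop (nhds m) := by
    have h1 := tendsto_dot_zero νh (fun N => νh N - ν N) m hm hee
    have h2 := (hm.sub (h1.const_mul 2)).add hee
    simp only [mul_zero, sub_zero, add_zero] at h2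
    refine h2.congr fun N => ?_
    simp only [dotProduct_sub, sub_dotProduct, dotProduct_comm (ν N) (νh N)]
    ring
  refine ⟨hee, hνν, ?_⟩
  have h1 : Tendsto (fun N => ∑ i, (νh N - ν N) i) atTop (nhds 0) := by
    have hr : Tendsto (fun N => (fun i => ν N (Fin.rev i)) ⬝ᵥ (fun i => ν N (Fin.rev i)))
        atTop (nhds m) := by
      refine hνν.congr fun N => ?_
      simp only [dotProduct]
      exact (Equiv.sum_comp Fin.revPerm (fun i => ν N i * ν N i)).symm
    refine (tendsto_dot_zero _ _ m hr hεε).congr' ?_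
    filter_upwards [hAe] with N h
    rw [sum_eq_rev p θ (a N) N (ν N) (νh N - ν N) (hν N), h]
  have h2 := hs.sub h1
  simp only [sub_zero] at h2
  refine h2.congr fun N => ?_
  simp

lemma resid (p θ a r g μ M c0 c1 c2 : ℝ) (N : ℕ) (hp : 1 < p) (hθ : 0 < θ) (ha : 0 < a)
    (ha1 : a < 1) (hpa : 1 < p * a) (hr : r < a) (hg : g = 1 / (((p + 1) / 2 + 2 * θ) * (1 - a) + (p + 1) * a))
    (hμ : μ = (p - a) / (p * a - 1)) (hM : M = μ ^ (N + 1))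
    (h0 : c0 = g * (1 - a)) (h1 : c1 = (a - r) * g * (1 + 1 / (p * M)))
    (h2 : c2 = g * (1 - a ^ 2) / ((p * a - 1) * M)) (i : Fin (N + 1)) :
    (AA p θ a N *ᵥ (fun j => c0 + c1 * r ^ j.val + c2 * μ ^ j.val)) i =
      1 + (c1 * ((p + 1) / 2 + 2 * θ + p * a / (r - a) + a * r / (1 - a * r)) * r ^ i.val
        + c2 * ((p + 1) / 2 + 2 * θ - a * (p + 1) / (1 + a)) * μ ^ i.val
        - c1 * r ^ (N + 1) / (1 - a * r) * a ^ (N + 1 - i.val)) := by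
  have hμpos : 0 < μ := by rw [hμ]; apply div_pos <;> linarith
  have hMpos : 0 < M := by rw [hM]; positivity
  have e1 : (fun j : Fin (N+1) => c0 + c1 * r ^ j.val + c2 * μ ^ j.val) =
      c0 • (fun j : Fin (N+1) => (1:ℝ) ^ j.val) + c1 • (fun j : Fin (N+1) => r ^ j.val)
      + c2 • (fun j : Fin (N+1) => μ ^ j.val) := by
    ext j; simp
  obtain ⟨d, hd⟩ : ∃ d, d = p * a - 1 := ⟨_, rfl⟩
  rw [← hd] at hμ h2
  have k0 : d ≠ 0 := by linarith
  have k1 : 1 - a ≠ 0 := by linarith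
  have k2 : r - a ≠ 0 := by linarith
  have k3 : 1 - a * r ≠ 0 := by nlinarith
  have ka : 1 + a ≠ 0 := by linarith
  have m1 : μ - a = p * (1 - a) * (1 + a) / d := by
    rw [hμ]; field_simp; rw [hd]; ring
  have m2 : 1 - a * μ = - ((1 - a) * (1 + a)) / d := by
    rw [hμ]; field_simp; rw [hd]; ring
  have k4 : μ - a ≠ 0 := by
    rw [m1]; apply div_ne_zero _ k0; apply mul_ne_zero _ ka; apply mul_ne_zero _ k1; linarith
  have k5 : 1 - a * μ ≠ 0 := by
    rw [m2]; apply div_ne_zero _ k0; exact neg_ne_zero.mpr (mul_ne_zero k1 ka)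
  rw [e1, Matrix.mulVec_add, Matrix.mulVec_add, Matrix.mulVec_smul, Matrix.mulVec_smul,
    Matrix.mulVec_smul]
  simp only [Pi.add_apply, Pi.smul_apply, smul_eq_mul]
  rw [AA_geo p θ a 1 k1 (by simpa using k1), AA_geo p θ a r k2 k3, AA_geo p θ a μ k4 k5]
  have hgp : ((p + 1) / 2 + 2 * θ) * (1 - a) + (p + 1) * a ≠ 0 := by
    have : 0 < (1 - a) := by linarith
    positivity
  have hp0 : p ≠ 0 := by linarith
  have b0 : c0 * ((p + 1) / 2 + 2 * θ + p * a / (1 - a) + a * 1 / (1 - a * 1)) = 1 := by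
    have q : c0 * ((p + 1) / 2 + 2 * θ + p * a / (1 - a) + a * 1 / (1 - a * 1)) =
        g * (((p + 1) / 2 + 2 * θ) * (1 - a) + (p + 1) * a) := by
      rw [h0, mul_one]; field_simp; ring
    rw [q, hg, one_div, inv_mul_cancel₀ hgp]
  have b1 : c0 / (1 - a) + c1 / (r - a) + c2 / (μ - a) = 0 := by
    
    have q1 : c0 / (1 - a) = g := by rw [h0]; field_simp
    have q2 : c1 / (r - a) = - (g * (1 + 1 / (p * M))) := by
      rw [h1, div_eq_iff k2]; ring
    have q3 : c2 / (μ - a) = g / (p * M) := by rw [m1, h2]; field_simp; ring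
    rw [q1, q2, q3]; ring
  have b2 : c0 / (1 - a) + c2 * M / (1 - a * μ) = 0 := by
    rw [m2, h0, h2]; field_simp; ring
  have b3 : p * a / (μ - a) + a * μ / (1 - a * μ) = - (a * (p + 1) / (1 + a)) := by
    rw [m1, m2, hμ]; field_simp; rw [hd]; ring
  rw [hM] at b2
  simp only [one_pow, mul_one, one_mul] at b0 ⊢
  generalize ((p + 1) / 2 + 2 * θ) = β at *
  have b3' : β + p * a / (μ - a) + a * μ / (1 - a * μ) = β - a * (p + 1) / (1 + a) := by
    rw [add_assoc, b3]; ring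
  rw [b3']
  linear_combination b0 - p * a ^ (i.val + 1) * b1 - a ^ (N + 1 - i.val) * b2

lemma tendsto_inv_nat : Tendsto (fun N : ℕ => ((N : ℝ))⁻¹) atTop (nhds 0) :=
  tendsto_inv_atTop_nhds_zero_nat

lemma small_lim (u : ℕ → ℝ) (U : ℝ) (h : Tendsto (fun N : ℕ => (N : ℝ) * u N) atTop (nhds U)) :
    Tendsto u atTop (nhds 0) ∧ Tendsto (fun N : ℕ => ((N : ℝ) + 1) * u N) atTop (nhds U) ∧
    Tendsto (fun N : ℕ => ((N : ℝ) + 1) * u N ^ 2) atTop (nhds 0) := by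
  have h1 : Tendsto u atTop (nhds 0) := by
    have := tendsto_inv_nat.mul h
    rw [zero_mul] at this
    refine this.congr' ?_
    filter_upwards [eventually_ge_atTop 1] with N hN
    have : (N : ℝ) ≠ 0 := by positivity
    field_simp
  have h2 : Tendsto (fun N : ℕ => ((N : ℝ) + 1) * u N) atTop (nhds U) := by
    have := h.add h1
    rw [add_zero] at this
    exact this.congr fun N => by ring
  refine ⟨h1, h2, ?_⟩
  have := h2.mul h1
  rw [mul_zero] at this
  exact this.congr fun N => by ring

def aS (b : ℝ) (N : ℕ) : ℝ := Real.exp (-b / N)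
def gS (p θ b : ℝ) (N : ℕ) : ℝ :=
  1 / (((p + 1) / 2 + 2 * θ) * (1 - aS b N) + (p + 1) * aS b N)
def mS (p b : ℝ) (N : ℕ) : ℝ := (p - aS b N) / (p * aS b N - 1)
def MS (p b : ℝ) (N : ℕ) : ℝ := mS p b N ^ (N + 1)
def rS (p θ : ℝ) : ℝ := (2 * θ - (p - 1) / 2) / (2 * θ + (p - 1) / 2)
def c0S (p θ b : ℝ) (N : ℕ) : ℝ := gS p θ b N * (1 - aS b N)
def c1S (p θ b : ℝ) (N : ℕ) : ℝ := (aS b N - rS p θ) * gS p θ b N * (1 + 1 / (p * MS p b N))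
def c2S (p θ b : ℝ) (N : ℕ) : ℝ :=
  gS p θ b N * (1 - aS b N ^ 2) / ((p * aS b N - 1) * MS p b N)
def yS (p θ b : ℝ) (N : ℕ) : Fin (N + 1) → ℝ := fun i => c1S p θ b N * rS p θ ^ i.val
def bS (p θ b : ℝ) (N : ℕ) : Fin (N + 1) → ℝ :=
  fun i => c0S p θ b N + c2S p θ b N * mS p b N ^ i.val

lemma aS_lim (b : ℝ) : Tendsto (fun N : ℕ => (N : ℝ) * (1 - aS b N)) atTop (nhds b) := by
  have h : HasDerivAt (fun x : ℝ => Real.exp (-b * x)) (-b) 0 := by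
    have := ((hasDerivAt_id (0:ℝ)).const_mul (-b)).exp
    simpa using this
  have h2 := h.tendsto_slope
  have h3 : Tendsto (fun N : ℕ => ((N : ℝ))⁻¹) atTop (nhdsWithin 0 {0}ᶜ) := by
    rw [tendsto_nhdsWithin_iff]
    refine ⟨tendsto_inv_nat, ?_⟩
    filter_upwards [eventually_ge_atTop 1] with N hN
    have : (N : ℝ) ≠ 0 := by positivity
    simpa using this
  have h4 := (h2.comp h3).neg
  rw [neg_neg] at h4
  refine h4.congr fun N => ?_
  simp [slope_def_field, aS]
  rw [← div_eq_mul_inv]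
  ring

lemma aS_pos (b : ℝ) (N : ℕ) : 0 < aS b N := Real.exp_pos _
lemma aS_le (b : ℝ) (hb : 0 < b) (N : ℕ) : aS b N ≤ 1 := by
  unfold aS
  rw [Real.exp_le_one_iff, neg_div]
  have : 0 ≤ b / N := by positivity
  linarith
lemma aS_lt (b : ℝ) (hb : 0 < b) (N : ℕ) (hN : 1 ≤ N) : aS b N < 1 := by
  unfold aS
  rw [Real.exp_lt_one_iff, neg_div]
  have : 0 < b / N := by positivity
  linarith

lemma aS_one (b : ℝ) : Tendsto (aS b) atTop (nhds 1) := by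
  have := (small_lim _ _ (aS_lim b)).1
  have h := this.const_sub 1
  simpa using h

section
variable (p θ b : ℝ) (hp : 1 < p) (hθ : 0 < θ) (hb : 0 < b)

lemma rS_lt (p θ : ℝ) (hp : 1 < p) (hθ : 0 < θ) : rS p θ < 1 := by
  have : 0 < 2 * θ + (p - 1) / 2 := by linarith
  rw [rS, div_lt_one this]; linarith

lemma rS_gt (p θ : ℝ) (hp : 1 < p) (hθ : 0 < θ) : -1 < rS p θ := by
  have : 0 < 2 * θ + (p - 1) / 2 := by linarith
  rw [rS, lt_div_iff₀ this]; linarith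

lemma gS_lim (p θ b : ℝ) (hp : 1 < p) : Tendsto (gS p θ b) atTop (nhds (1 / (p + 1))) := by
  have h := aS_one b
  have h1 := ((h.const_sub 1).const_mul ((p + 1) / 2 + 2 * θ)).add (h.const_mul (p + 1))
  have h2 := (tendsto_const_nhds (x := (1:ℝ)) (f := atTop (α := ℕ))).div h1 (by norm_num; linarith)
  simp only [sub_self, mul_zero, zero_add, mul_one] at h2
  exact h2

lemma den_lim (p b : ℝ) : Tendsto (fun N => p * aS b N - 1) atTop (nhds (p - 1)) := by
  simpa using ((aS_one b).const_mul p).sub_const 1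

lemma mS_lim (p b : ℝ) (hp : 1 < p) :
    Tendsto (fun N : ℕ => (N : ℝ) * (mS p b N - 1)) atTop (nhds (b * (p + 1) / (p - 1))) := by
  have h := ((aS_lim b).mul_const (p + 1)).div (den_lim p b) (by linarith)
  refine h.congr' ?_
  filter_upwards [(den_lim p b).eventually_const_lt (show 0 < p - 1 by linarith)] with N hN
  simp only [mS, Pi.div_apply]
  have : p * aS b N - 1 ≠ 0 := hN.ne'
  rw [div_sub_one this]
  ring

lemma MS_lim (p b : ℝ) (hp : 1 < p) :
    Tendsto (MS p b) atTop (nhds (Real.exp (b * (p + 1) / (p - 1)))) := by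
  have h := Real.tendsto_one_add_pow_exp_of_tendsto (mS_lim p b hp)
  have h1 := (small_lim _ _ (mS_lim p b hp)).1
  have h2 := h.mul (h1.const_add 1)
  simp only [add_zero, mul_one] at h2
  refine h2.congr fun N => ?_
  simp only [MS, pow_succ]
  ring

lemma c0_lim (p θ b : ℝ) (hp : 1 < p) :
    Tendsto (fun N : ℕ => (N : ℝ) * c0S p θ b N) atTop (nhds (b / (p + 1))) := by
  have h := (gS_lim p θ b hp).mul (aS_lim b)
  rw [one_div_mul_eq_div] at h
  refine h.congr fun N => ?_
  simp only [c0S]; ring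

lemma c1_lim (p θ b : ℝ) (hp : 1 < p) :
    Tendsto (c1S p θ b) atTop (nhds ((1 - rS p θ) * (1 / (p + 1)) *
      (1 + 1 / (p * Real.exp (b * (p + 1) / (p - 1)))))) := by
  have h := (((aS_one b).sub_const (rS p θ)).mul (gS_lim p θ b hp)).mul
    (((tendsto_const_nhds (x := (1:ℝ))).div ((MS_lim p b hp).const_mul p)
      (by have := Real.exp_pos (b * (p + 1) / (p - 1)); positivity)).const_add 1)
  exact h

lemma c2_lim (p θ b : ℝ) (hp : 1 < p) :
    Tendsto (fun N : ℕ => (N : ℝ) * c2S p θ b N) atTop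
      (nhds ((1 / (p + 1)) * (b * 2) / ((p - 1) * Real.exp (b * (p + 1) / (p - 1))))) := by
  have h := ((gS_lim p θ b hp).mul ((aS_lim b).mul ((aS_one b).const_add 1))).div
    ((den_lim p b).mul (MS_lim p b hp))
    (by have := Real.exp_pos (b * (p + 1) / (p - 1)); have : p - 1 ≠ 0 := by linarith
        positivity)
  norm_num only at h
  refine Tendsto.congr (fun N => ?_) (by convert h using 2)
  simp only [c2S, Pi.div_apply]; ring

lemma good (p θ b : ℝ) (hp : 1 < p) (hθ : 0 < θ) (hb : 0 < b) :
    ∀ᶠ N in atTop, aS b N < 1 ∧ 1 < p * aS b N ∧ rS p θ < aS b N ∧ 1 ≤ mS p b N ∧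
      0 < gS p θ b N := by
  filter_upwards [eventually_ge_atTop 1,
    (den_lim p b).eventually_const_lt (show 0 < p - 1 by linarith),
    (aS_one b).eventually_const_lt (rS_lt p θ hp hθ)] with N h1 h2 h3
  have h4 := aS_lt b hb N h1
  refine ⟨h4, by linarith, h3, ?_, ?_⟩
  · rw [mS, le_div_iff₀ h2]; nlinarith
  · have := aS_pos b N
    have h5 : 0 < 1 - aS b N := by linarith
    rw [gS]; positivity
end

lemma fin_geom (r : ℝ) (hr : r ≠ 1) (N : ℕ) :
    ∑ i : Fin (N + 1), r ^ i.val = (r ^ (N + 1) - 1) / (r - 1) := by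
  rw [Fin.sum_univ_eq_sum_range (fun i => r ^ i), geom_sum_eq hr]

lemma pow_lim (r : ℝ) (h1 : -1 < r) (h2 : r < 1) :
    Tendsto (fun N : ℕ => r ^ (N + 1)) atTop (nhds 0) :=
  (tendsto_pow_atTop_nhds_zero_of_abs_lt_one (abs_lt.mpr ⟨h1, h2⟩)).comp (tendsto_add_atTop_nat 1)

lemma geom_lim (r : ℝ) (h1 : -1 < r) (h2 : r < 1) :
    Tendsto (fun N : ℕ => ∑ i : Fin (N + 1), r ^ i.val) atTop (nhds (1 / (1 - r))) := by
  have h := ((pow_lim r h1 h2).sub_const 1).div_const (r - 1)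
  have e : (0 - 1) / (r - 1) = 1 / (1 - r) := by
    rw [zero_sub, ← neg_sub 1 r, neg_div_neg_eq]
  rw [e] at h
  exact h.congr fun N => (fin_geom r h2.ne N).symm

lemma yy_lim (p θ b : ℝ) (hp : 1 < p) (hθ : 0 < θ) :
    Tendsto (fun N => yS p θ b N ⬝ᵥ yS p θ b N) atTop (nhds (((1 - rS p θ) * (1 / (p + 1)) *
      (1 + 1 / (p * Real.exp (b * (p + 1) / (p - 1))))) ^ 2 * (1 / (1 - rS p θ ^ 2)))) := by
  have k1 := rS_lt p θ hp hθ
  have k2 := rS_gt p θ hp hθ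
  have h := ((c1_lim p θ b hp).pow 2).mul (geom_lim (rS p θ ^ 2) (by nlinarith) (by nlinarith))
  refine h.congr fun N => ?_
  simp only [dotProduct, yS, mul_sum]
  apply sum_congr rfl
  intro i _
  ring

lemma ysum_lim (p θ b : ℝ) (hp : 1 < p) (hθ : 0 < θ) :
    Tendsto (fun N => ∑ i, yS p θ b N i) atTop (nhds (((1 - rS p θ) * (1 / (p + 1)) *
      (1 + 1 / (p * Real.exp (b * (p + 1) / (p - 1))))) * (1 / (1 - rS p θ)))) := by
  have k1 := rS_lt p θ hp hθ
  have k2 := rS_gt p θ hp hθ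
  have h := (c1_lim p θ b hp).mul (geom_lim (rS p θ) k2 k1)
  refine h.congr fun N => ?_
  simp only [yS, mul_sum]

lemma bb_lim (p θ b : ℝ) (hp : 1 < p) (hθ : 0 < θ) (hb : 0 < b) :
    Tendsto (fun N => bS p θ b N ⬝ᵥ bS p θ b N) atTop (nhds 0) := by
  have h := (small_lim (fun N => c0S p θ b N + c2S p θ b N * MS p b N) _
    (((c0_lim p θ b hp).add ((c2_lim p θ b hp).mul (MS_lim p b hp))).congr fun N => by ring)).2.2
  refine squeeze_zero' (Eventually.of_forall fun N => dot_self_nonneg _) ?_ h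
  filter_upwards [good p θ b hp hθ hb] with N ⟨h1, h2, h3, h4, h5⟩
  have hM : 0 < MS p b N := by unfold MS; positivity
  have hc0 : 0 ≤ c0S p θ b N := mul_nonneg h5.le (by linarith)
  have hc2 : 0 ≤ c2S p θ b N := by
    have := aS_pos b N
    unfold c2S
    apply div_nonneg
    · apply mul_nonneg h5.le; nlinarith
    · apply mul_nonneg _ hM.le; linarith
  calc bS p θ b N ⬝ᵥ bS p θ b N ≤ ∑ i : Fin (N + 1), (c0S p θ b N + c2S p θ b N * MS p b N) ^ 2 := by
        apply sum_le_sum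
        intro i _
        rw [← pow_two]
        have : mS p b N ^ i.val ≤ MS p b N := pow_le_pow_right₀ h4 i.2.le
        have h0 : 0 ≤ mS p b N := by linarith
        simp only [bS]
        gcongr
    _ = _ := by simp

lemma bsum_lim (p θ b : ℝ) (hp : 1 < p) (hθ : 0 < θ) (hb : 0 < b) :
    Tendsto (fun N => ∑ i, bS p θ b N i) atTop
      (nhds (b / (p + 1) + (1 / (p + 1)) * 2 / ((p + 1) * Real.exp (b * (p + 1) / (p - 1))) *
        (Real.exp (b * (p + 1) / (p - 1)) - 1))) := by
  have h1 := (small_lim _ _ (c0_lim p θ b hp)).2.1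
  have hE := Real.exp_pos (b * (p + 1) / (p - 1))
  have h2 := (((gS_lim p θ b hp).mul ((aS_one b).const_add 1)).div
    ((MS_lim p b hp).const_mul (p + 1)) (by positivity)).mul ((MS_lim p b hp).sub_const 1)
  norm_num only at h2
  refine Tendsto.congr' ?_ (h1.add (by convert h2 using 2))
  filter_upwards [good p θ b hp hθ hb] with N ⟨h1, h2, h3, h4, h5⟩
  have hM : 0 < MS p b N := by unfold MS; positivity
  have hd : p * aS b N - 1 ≠ 0 := by linarith
  have e : mS p b N - 1 = (p + 1) * (1 - aS b N) / (p * aS b N - 1) := by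
    rw [mS, div_sub_one hd]; ring
  have h1a : 1 - aS b N ≠ 0 := by linarith
  have hm1 : mS p b N ≠ 1 := by
    intro h
    have : (p + 1) * (1 - aS b N) / (p * aS b N - 1) ≠ 0 :=
      div_ne_zero (mul_ne_zero (by linarith) h1a) hd
    rw [← e, h] at this
    simp at this
  simp only [bS, sum_add_distrib, ← mul_sum, fin_geom _ hm1, Pi.div_apply]
  rw [e, ← MS, c2S]
  have hp1 : p + 1 ≠ 0 := by linarith
  simp only [sum_const, card_univ, Fintype.card_fin, nsmul_eq_mul, Nat.cast_add, Nat.cast_one]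
  congr 1
  generalize p * aS b N - 1 = d at *
  field_simp
  ring

def eS (p θ b : ℝ) (N : ℕ) : Fin (N + 1) → ℝ := fun i =>
  c1S p θ b N * ((p + 1) / 2 + 2 * θ + p * aS b N / (rS p θ - aS b N)
      + aS b N * rS p θ / (1 - aS b N * rS p θ)) * rS p θ ^ i.val
    + c2S p θ b N * ((p + 1) / 2 + 2 * θ - aS b N * (p + 1) / (1 + aS b N)) * mS p b N ^ i.val
    - c1S p θ b N * rS p θ ^ (N + 1) / (1 - aS b N * rS p θ) * aS b N ^ (N + 1 - i.val)

lemma eS_eq (p θ b : ℝ) (hp : 1 < p) (hθ : 0 < θ) (hb : 0 < b) :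
    ∀ᶠ N in atTop, AA p θ (aS b N) N *ᵥ (yS p θ b N + bS p θ b N) = 1 + eS p θ b N := by
  filter_upwards [good p θ b hp hθ hb] with N ⟨h1, h2, h3, h4, h5⟩
  ext i
  have h := resid p θ (aS b N) (rS p θ) _ _ _ _ _ _ N hp hθ (aS_pos b N) h1 h2 h3 rfl rfl rfl
    rfl rfl rfl i
  have e : yS p θ b N + bS p θ b N = fun j => gS p θ b N * (1 - aS b N) +
      c1S p θ b N * rS p θ ^ j.val + c2S p θ b N * mS p b N ^ j.val := by
    ext j; simp only [Pi.add_apply, yS, bS, c0S]; ring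
  rw [e]
  exact h

lemma ee_lim (p θ b : ℝ) (hp : 1 < p) (hθ : 0 < θ) (hb : 0 < b) :
    Tendsto (fun N => eS p θ b N ⬝ᵥ eS p θ b N) atTop (nhds 0) := by
  have k1 := rS_lt p θ hp hθ
  have k2 := rS_gt p θ hp hθ
  have hr2 : 0 < 1 - rS p θ ^ 2 := by nlinarith
  have ha := aS_one b
  have hA : Tendsto (fun N => c1S p θ b N * ((p + 1) / 2 + 2 * θ + p * aS b N / (rS p θ - aS b N)
      + aS b N * rS p θ / (1 - aS b N * rS p θ))) atTop (nhds 0) := by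
    have h := (c1_lim p θ b hp).mul ((((ha.const_mul p).div (ha.const_sub (rS p θ))
      (by linarith)).const_add ((p + 1) / 2 + 2 * θ)).add ((ha.mul_const (rS p θ)).div
        ((ha.mul_const (rS p θ)).const_sub 1) (by linarith)))
    have e : (p + 1) / 2 + 2 * θ + p * 1 / (rS p θ - 1) + 1 * rS p θ / (1 - 1 * rS p θ) = 0 := by
      have hB : 2 * θ + (p - 1) / 2 ≠ 0 := by
        have : 0 < 2 * θ + (p - 1) / 2 := by linarith
        exact this.ne'
      have hr : 1 - rS p θ = (p - 1) / (2 * θ + (p - 1) / 2) := by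
        rw [rS, eq_div_iff hB, sub_mul, div_mul_cancel₀ _ hB]; ring
      have h1 : rS p θ - 1 = - ((p - 1) / (2 * θ + (p - 1) / 2)) := by rw [← hr]; ring
      have h2 : rS p θ = 1 - (p - 1) / (2 * θ + (p - 1) / 2) := by rw [← hr]; ring
      have hp1 : p - 1 ≠ 0 := by linarith
      rw [one_mul, hr, h1, h2]
      obtain ⟨B, hBB⟩ : ∃ B, B = 2 * θ + (p - 1) / 2 := ⟨_, rfl⟩
      have : (p + 1) / 2 + 2 * θ = B + 1 := by rw [hBB]; ring
      rw [this]
      rw [← hBB] at hB ⊢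
      field_simp
      ring
    rw [e, mul_zero] at h
    exact h
  have hB := (small_lim (fun N => c2S p θ b N * ((p + 1) / 2 + 2 * θ -
      aS b N * (p + 1) / (1 + aS b N)) * MS p b N) _
    ((((c2_lim p θ b hp).mul (((ha.mul_const (p + 1)).div (ha.const_add 1)
      (by norm_num)).const_sub ((p + 1) / 2 + 2 * θ))).mul (MS_lim p b hp)).congr
        fun N => by simp only [Pi.div_apply]; ring)).2.2
  have hC : Tendsto (fun N : ℕ => ((N : ℝ) + 1) *
      (c1S p θ b N * rS p θ ^ (N + 1) / (1 - aS b N * rS p θ)) ^ 2) atTop (nhds 0) := by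
    have h1 := (((c1_lim p θ b hp).div ((ha.mul_const (rS p θ)).const_sub 1)
      (by linarith)).pow 2)
    have h2 := (tendsto_self_mul_const_pow_of_lt_one (sq_nonneg (rS p θ)) (by linarith)).comp
      (tendsto_add_atTop_nat 1)
    have h3 := h1.mul h2
    rw [mul_zero] at h3
    refine h3.congr fun N => ?_
    simp only [Function.comp, Pi.div_apply]
    push_cast
    ring
  have hT := (((hA.pow 2).div_const (1 - rS p θ ^ 2)).add (hB.add hC)).const_mul 3
  norm_num only [zero_div] at hT
  refine squeeze_zero' (Eventually.of_forall fun N => dot_self_nonneg _) ?_ hT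
  filter_upwards [good p θ b hp hθ hb] with N ⟨h1, h2, h3, h4, h5⟩
  have ha0 := aS_pos b N
  simp only [dotProduct, eS]
  generalize c1S p θ b N * ((p + 1) / 2 + 2 * θ + p * aS b N / (rS p θ - aS b N)
      + aS b N * rS p θ / (1 - aS b N * rS p θ)) = A
  generalize c2S p θ b N * ((p + 1) / 2 + 2 * θ - aS b N * (p + 1) / (1 + aS b N)) = B
  generalize c1S p θ b N * rS p θ ^ (N + 1) / (1 - aS b N * rS p θ) = C
  calc _ ≤ ∑ i : Fin (N + 1), 3 * (A ^ 2 * (rS p θ ^ 2) ^ i.val + ((B * MS p b N) ^ 2 + C ^ 2)) := by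
        apply sum_le_sum
        intro i _
        have e1 : mS p b N ^ i.val ≤ MS p b N := pow_le_pow_right₀ h4 i.2.le
        have e2 : 0 ≤ mS p b N ^ i.val := by positivity
        have e3 : aS b N ^ (N + 1 - i.val) ≤ 1 := pow_le_one₀ ha0.le h1.le
        have e4 : 0 ≤ aS b N ^ (N + 1 - i.val) := by positivity
        have e5 : (B * mS p b N ^ i.val) ^ 2 ≤ (B * MS p b N) ^ 2 := by
          rw [mul_pow, mul_pow]; gcongr
        have e6 : (C * aS b N ^ (N + 1 - i.val)) ^ 2 ≤ C ^ 2 := by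
          rw [mul_pow]
          have : (aS b N ^ (N + 1 - i.val)) ^ 2 ≤ 1 := pow_le_one₀ e4 e3
          nlinarith [sq_nonneg C]
        have e7 : A ^ 2 * (rS p θ ^ 2) ^ i.val = (A * rS p θ ^ i.val) ^ 2 := by ring
        rw [e7]
        generalize A * rS p θ ^ i.val = X at *
        generalize B * mS p b N ^ i.val = Y at *
        generalize C * aS b N ^ (N + 1 - i.val) = Z at *
        nlinarith [sq_nonneg (X - Y), sq_nonneg (X + Z), sq_nonneg (Y + Z)]
    _ = 3 * (A ^ 2 * ∑ i : Fin (N + 1), (rS p θ ^ 2) ^ i.val +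
          (((N : ℝ) + 1) * (B * MS p b N) ^ 2 + ((N : ℝ) + 1) * C ^ 2)) := by
        rw [← mul_sum, sum_add_distrib, ← mul_sum]
        simp
    _ ≤ _ := by
        rw [div_eq_mul_inv (A ^ 2)]
        have hg : ∑ i : Fin (N + 1), (rS p θ ^ 2) ^ i.val ≤ (1 - rS p θ ^ 2)⁻¹ := by
          rw [fin_geom _ (by linarith), ← neg_div_neg_eq, neg_sub, neg_sub, ← one_div]
          gcongr
          have : 0 ≤ (rS p θ ^ 2) ^ (N + 1) := by positivity
          linarith
        gcongr

lemma nu_main (p θ b : ℝ) (hp : 1 < p) (hθ : 0 < θ) (hb : 0 < b) (ν : ∀ N : ℕ, Fin (N + 1) → ℝ)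
    (hν : ∀ N, AA p θ (aS b N) N *ᵥ ν N = 1) (E : ℝ) (hE : E = Real.exp (b * (p + 1) / (p - 1))) :
    Tendsto (fun N => (yS p θ b N + bS p θ b N - ν N) ⬝ᵥ (yS p θ b N + bS p θ b N - ν N))
      atTop (nhds 0) ∧
    Tendsto (fun N => ν N ⬝ᵥ ν N) atTop
      (nhds (((1 - rS p θ) * (1 / (p + 1)) * (1 + 1 / (p * E))) ^ 2 * (1 / (1 - rS p θ ^ 2)))) ∧
    Tendsto (fun N => ∑ i, ν N i) atTop (nhds
      (((1 - rS p θ) * (1 / (p + 1)) * (1 + 1 / (p * E))) * (1 / (1 - rS p θ)) +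
        (b / (p + 1) + (1 / (p + 1)) * 2 / ((p + 1) * E) * (E - 1)))) := by
  rw [hE]
  apply stab p θ (by linarith) hθ (aS b) (fun N => (aS_pos b N).le) (aS_le b hb) ν
    (fun N => yS p θ b N + bS p θ b N) (eS p θ b) hν (eS_eq p θ b hp hθ hb) _ _
    (ee_lim p θ b hp hθ hb)
  · have h1 := yy_lim p θ b hp hθ
    have h2 := bb_lim p θ b hp hθ hb
    have h3 := tendsto_dot_zero _ _ _ h1 h2
    have h := (h1.add (h3.const_mul 2)).add h2
    simp only [mul_zero, add_zero] at h
    refine h.congr fun N => ?_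
    simp only [dotProduct_add, add_dotProduct, dotProduct_comm (bS p θ b N) (yS p θ b N)]
    ring
  · have h := (ysum_lim p θ b hp hθ).add (bsum_lim p θ b hp hθ hb)
    refine h.congr fun N => ?_
    simp only [Pi.add_apply, sum_add_distrib]

def qS (θ a : ℝ) : ℝ := a * (1 - 1 / (1 / 2 + 2 * θ))
def d0S (θ a : ℝ) : ℝ := (1 - a) / ((1 / 2 + 2 * θ) * (1 - a) + a)
def d1S (θ a : ℝ) : ℝ := a / ((1 / 2 + 2 * θ) * ((1 / 2 + 2 * θ) * (1 - a) + a))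
def oS (θ a : ℝ) (N : ℕ) : Fin (N + 1) → ℝ := fun i => d0S θ a + d1S θ a * qS θ a ^ (Fin.rev i).val

lemma LLT_rev (a : ℝ) (N : ℕ) (f : Fin (N + 1) → ℝ) (i : Fin (N + 1)) :
    ((LL a N)ᵀ *ᵥ (fun j => f (Fin.rev j))) i = (LL a N *ᵥ f) (Fin.rev i) := by
  simp only [Matrix.mulVec, dotProduct, Matrix.transpose_apply]
  rw [← Equiv.sum_comp Fin.revPerm]
  apply sum_congr rfl
  intro j _
  simp only [Fin.revPerm_apply, Fin.rev_rev]
  congr 1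
  have h1 : (Fin.rev j < i) ↔ (Fin.rev i < j) := by
    simp only [Fin.lt_def, Fin.val_rev]; omega
  have h2 : (Fin.rev j = i) ↔ (Fin.rev i = j) := by
    simp only [Fin.ext_iff, Fin.val_rev]; omega
  have h3 : (Fin.rev j).val - i.val = (Fin.rev i).val - j.val := by
    simp only [Fin.val_rev]; omega
  simp only [LL, Matrix.of_apply, h1, h2, h3]

lemma oS_eq (θ a : ℝ) (hθ : 0 < θ) (ha : 0 < a) (ha1 : a < 1) (N : ℕ) :
    AA 0 θ a N *ᵥ oS θ a N = 1 := by
  ext i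
  have e : (LL a N *ᵥ (fun j => d0S θ a + d1S θ a * qS θ a ^ j.val)) =
      d0S θ a • (LL a N *ᵥ (fun j => (1:ℝ) ^ j.val)) +
      d1S θ a • (LL a N *ᵥ (fun j => qS θ a ^ j.val)) := by
    rw [← Matrix.mulVec_smul, ← Matrix.mulVec_smul, ← Matrix.mulVec_add]
    congr 1
    ext j; simp
  have hκ : 0 < 1 / 2 + 2 * θ := by linarith
  have hq : qS θ a - a = - (a / (1 / 2 + 2 * θ)) := by rw [qS]; ring
  have hq0 : qS θ a - a ≠ 0 := by rw [hq]; exact neg_ne_zero.mpr (by positivity)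
  have h1a : 1 - a ≠ 0 := by linarith
  simp only [AA, Matrix.add_mulVec, Pi.add_apply, Matrix.smul_mulVec, Pi.smul_apply,
    Matrix.one_mulVec, smul_eq_mul, zero_mul, add_zero, Pi.one_apply]
  have := LLT_rev a N (fun j => d0S θ a + d1S θ a * qS θ a ^ j.val) i
  rw [e] at this
  unfold oS
  rw [this]
  simp only [Pi.add_apply, Pi.smul_apply, smul_eq_mul]
  rw [LL_mulVec a N (fun j => (1:ℝ) ^ j), LL_mulVec a N (fun j => qS θ a ^ j),
    low_geo a 1 h1a, low_geo a _ hq0]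
  generalize (Fin.rev i).val = k
  have hden : (1 / 2 + 2 * θ) * (1 - a) + a ≠ 0 := by
    have : 0 < 1 - a := by linarith
    positivity
  have t1 : a * (qS θ a ^ k - a ^ k) / (qS θ a - a) = - (1 / 2 + 2 * θ) * (qS θ a ^ k - a ^ k) := by
    rw [hq]; field_simp
  rw [t1]
  have t2 : d0S θ a = (1 - a) * (1 / ((1 / 2 + 2 * θ) * (1 - a) + a)) := by rw [d0S]; ring
  have t3 : d1S θ a * (1 / 2 + 2 * θ) = a * (1 / ((1 / 2 + 2 * θ) * (1 - a) + a)) := by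
    rw [d1S]; field_simp
  have t4 : d0S θ a * (a * (1 ^ k - a ^ k) / (1 - a)) =
      a * (1 - a ^ k) * (1 / ((1 / 2 + 2 * θ) * (1 - a) + a)) := by
    rw [t2, one_pow]; field_simp
  have t5 : ((1 / 2 + 2 * θ) * (1 - a) + a) * (1 / ((1 / 2 + 2 * θ) * (1 - a) + a)) = 1 :=
    mul_one_div_cancel hden
  generalize (1 / ((1 / 2 + 2 * θ) * (1 - a) + a)) = G at *
  simp only [one_pow] at *
  linear_combination t4 + a ^ k * t3 + (1 / 2 + 2 * θ) * t2 + t5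

lemma q_bound (θ a : ℝ) (hθ : 0 < θ) (ha : 0 ≤ a) (ha1 : a ≤ 1) :
    |qS θ a| ≤ |1 - 1 / (1 / 2 + 2 * θ)| := by
  rw [qS, abs_mul, abs_of_nonneg ha]
  exact mul_le_of_le_one_left (abs_nonneg _) ha1

lemma q_lt (θ : ℝ) (hθ : 0 < θ) : |1 - 1 / (1 / 2 + 2 * θ)| < 1 := by
  have hκ : 0 < 1 / 2 + 2 * θ := by linarith
  have h1 : 0 < 1 / (1 / 2 + 2 * θ) := by positivity
  have h2 : 1 / (1 / 2 + 2 * θ) < 2 := by rw [div_lt_iff₀ hκ]; linarith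
  rw [abs_lt]; constructor <;> linarith

lemma oden_lim (θ b : ℝ) :
    Tendsto (fun N => (1 / 2 + 2 * θ) * (1 - aS b N) + aS b N) atTop (nhds 1) := by
  have ha := aS_one b
  have := ((ha.const_sub 1).const_mul (1 / 2 + 2 * θ)).add ha
  simpa using this

lemma d0_lim (θ b : ℝ) : Tendsto (fun N : ℕ => (N : ℝ) * d0S θ (aS b N)) atTop (nhds b) := by
  have h := (aS_lim b).div (oden_lim θ b) one_ne_zero
  rw [div_one] at h
  refine h.congr fun N => ?_
  simp only [d0S, Pi.div_apply]; ring

lemma d1_lim (θ b : ℝ) (hθ : 0 < θ) :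
    Tendsto (fun N : ℕ => d1S θ (aS b N)) atTop (nhds (1 / (1 / 2 + 2 * θ))) := by
  have h := (aS_one b).div ((oden_lim θ b).const_mul (1 / 2 + 2 * θ)) (by positivity)
  rw [mul_one] at h
  exact h

lemma osum_lim (θ b : ℝ) (hθ : 0 < θ) (hb : 0 < b) :
    Tendsto (fun N => ∑ i, oS θ (aS b N) N i) atTop (nhds (b + 1)) := by
  have hκ : 0 < 1 / 2 + 2 * θ := by linarith
  have h1 := (small_lim _ _ (d0_lim θ b)).2.1
  have hq : Tendsto (fun N => qS θ (aS b N)) atTop (nhds (1 - 1 / (1 / 2 + 2 * θ))) := by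
    have := (aS_one b).mul_const (1 - 1 / (1 / 2 + 2 * θ))
    rw [one_mul] at this
    exact this
  have hqp : Tendsto (fun N => qS θ (aS b N) ^ (N + 1)) atTop (nhds 0) := by
    have h0 := (tendsto_pow_atTop_nhds_zero_of_lt_one (abs_nonneg _) (q_lt θ hθ)).comp
      (tendsto_add_atTop_nat 1)
    refine squeeze_zero_norm (fun N => ?_) h0
    simp only [Function.comp, norm_pow, Real.norm_eq_abs]
    exact pow_le_pow_left₀ (abs_nonneg _) (q_bound θ _ hθ (aS_pos b N).le (aS_le b hb N)) _
  have hk : 1 - 1 / (1 / 2 + 2 * θ) - 1 ≠ 0 := by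
    have : 0 < 1 / (1 / 2 + 2 * θ) := by positivity
    linarith
  have h2 := (d1_lim θ b hθ).mul ((hqp.sub_const 1).div (hq.sub_const 1) hk)
  have e : 1 / (1 / 2 + 2 * θ) * ((0 - 1) / (1 - 1 / (1 / 2 + 2 * θ) - 1)) = 1 := by
    have : (1 - 1 / (1 / 2 + 2 * θ) - 1) = - (1 / (1 / 2 + 2 * θ)) := by ring
    rw [this]; field_simp; norm_num
  rw [e] at h2
  refine (h1.add h2).congr fun N => ?_
  have hq1 : qS θ (aS b N) ≠ 1 := by
    have := (abs_lt.mp ((q_bound θ _ hθ (aS_pos b N).le (aS_le b hb N)).trans_lt (q_lt θ hθ))).2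
    exact this.ne
  simp only [oS]
  rw [← Equiv.sum_comp Fin.revPerm]
  simp only [Fin.revPerm_apply, Fin.rev_rev, sum_add_distrib, ← mul_sum, fin_geom _ hq1,
    Pi.div_apply]
  simp

lemma oy_lim (p θ b : ℝ) (hp : 1 < p) (hθ : 0 < θ) (hb : 0 < b) :
    Tendsto (fun N => oS θ (aS b N) N ⬝ᵥ yS p θ b N) atTop (nhds 0) := by
  have k1 := rS_lt p θ hp hθ
  have k2 := rS_gt p θ hp hθ
  have h1 := ((small_lim _ _ (d0_lim θ b)).1).mul (ysum_lim p θ b hp hθ)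
  set m := max |1 - 1 / (1 / 2 + 2 * θ)| |rS p θ| with hm
  have hm0 : 0 ≤ m := le_max_of_le_left (abs_nonneg _)
  have hm1 : m < 1 := max_lt (q_lt θ hθ) (abs_lt.mpr ⟨k2, k1⟩)
  have hs : Tendsto (fun N => ∑ i : Fin (N + 1), qS θ (aS b N) ^ (Fin.rev i).val * rS p θ ^ i.val)
      atTop (nhds 0) := by
    have h0 : Tendsto (fun N : ℕ => ((N : ℝ) + 1) * m ^ N) atTop (nhds 0) := by
      have := (tendsto_self_mul_const_pow_of_lt_one hm0 hm1).add
        (tendsto_pow_atTop_nhds_zero_of_lt_one hm0 hm1)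
      rw [add_zero] at this
      exact this.congr fun N => by ring
    refine squeeze_zero_norm (fun N => ?_) h0
    calc _ ≤ ∑ i : Fin (N + 1), m ^ N := by
          refine (norm_sum_le _ _).trans (sum_le_sum fun i _ => ?_)
          rw [norm_mul, norm_pow, norm_pow, Real.norm_eq_abs, Real.norm_eq_abs]
          have e : m ^ N = m ^ (Fin.rev i).val * m ^ i.val := by
            rw [← pow_add]; congr 1; rw [Fin.val_rev]; omega
          rw [e]
          have := (q_bound θ _ hθ (aS_pos b N).le (aS_le b hb N)).trans (le_max_left _ |rS p θ|)
          have h2 : |rS p θ| ≤ m := le_max_right _ _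
          gcongr
      _ = _ := by simp
  have h2 := ((d1_lim θ b hθ).mul (c1_lim p θ b hp)).mul hs
  have h := h1.add h2
  simp only [zero_mul, mul_zero, add_zero] at h
  refine h.congr fun N => ?_
  simp only [dotProduct, oS, yS, mul_sum, ← sum_add_distrib]
  apply sum_congr rfl
  intro i _
  ring

lemma tendsto_dot_zero' (x y : ∀ N : ℕ, Fin (N + 1) → ℝ) (B : ℕ → ℝ) (X : ℝ)
    (hx : ∀ᶠ N in atTop, x N ⬝ᵥ x N ≤ B N) (hB : Tendsto B atTop (nhds X))
    (hy : Tendsto (fun N => y N ⬝ᵥ y N) atTop (nhds 0)) :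
    Tendsto (fun N => x N ⬝ᵥ y N) atTop (nhds 0) := by
  have h0 := hB.mul hy
  rw [mul_zero] at h0
  refine tendsto_zero_of_sq_le _ _ ?_ h0
  filter_upwards [hx] with N h
  exact (dot_sq_le (x N) (y N)).trans (mul_le_mul_of_nonneg_right h (dot_self_nonneg _))

lemma onu_lim (p θ b : ℝ) (hp : 1 < p) (hθ : 0 < θ) (hb : 0 < b) (ν : ∀ N : ℕ, Fin (N + 1) → ℝ)
    (hν : ∀ N, AA p θ (aS b N) N *ᵥ ν N = 1) :
    Tendsto (fun N => oS θ (aS b N) N ⬝ᵥ ν N) atTop (nhds 0) := by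
  have hx : ∀ᶠ N in atTop, oS θ (aS b N) N ⬝ᵥ oS θ (aS b N) N ≤
      (∑ i, oS θ (aS b N) N i) / (2 * θ) := by
    filter_upwards [eventually_ge_atTop 1] with N hN
    have h := AA_coer 0 θ (aS b N) le_rfl (aS_pos b N).le (aS_le b hb N) N (oS θ (aS b N) N)
    rw [oS_eq θ _ hθ (aS_pos b N) (aS_lt b hb N hN), dotProduct_one] at h
    rw [le_div_iff₀ (by positivity)]
    linarith
  have hB := (osum_lim θ b hθ hb).div_const (2 * θ)
  have h1 := tendsto_dot_zero' _ _ _ _ hx hB (nu_main p θ b hp hθ hb ν hν _ rfl).1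
  have h2 := tendsto_dot_zero' _ _ _ _ hx hB (bb_lim p θ b hp hθ hb)
  have h := ((oy_lim p θ b hp hθ hb).add h2).sub h1
  simp only [add_zero, sub_zero] at h
  refine h.congr fun N => ?_
  simp only [dotProduct_add, dotProduct_sub]
  ring

lemma nuN_eq (n N : ℕ) (ρ T θ : ℝ) (hT : 0 < T) :
    nuN n N ρ T θ = (AA n θ (aS (ρ * T) N) N)⁻¹ *ᵥ 1 := by
  rw [nuN, Gam_eq ρ T θ hT, GamT_eq]
  congr 2
  rw [AA, aS, sub_smul, one_smul]
  abel

lemma omN_eq (N : ℕ) (ρ T θ : ℝ) (hT : 0 < T) :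
    omN N ρ T θ = (AA 0 θ (aS (ρ * T) N) N)⁻¹ *ᵥ 1 := by
  rw [omN, Gam_eq ρ T θ hT, GamT_eq]
  congr 2
  rw [AA, aS, zero_smul]
  abel

lemma xi_sum (n : ℕ) (hn : 2 ≤ n) (N : ℕ) (ρ T θ : ℝ) (x : Fin n → ℝ) :
    ∑ j, xiN n N ρ T θ x j = (∑ j, x j) • vN n N ρ T θ := by
  have h0 : (n : ℝ) ≠ 0 := by positivity
  simp only [xiN, sum_add_distrib, ← sum_smul, sum_sub_distrib, sum_const, card_univ,
    Fintype.card_fin]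
  rw [← Nat.cast_smul_eq_nsmul ℝ, smul_eq_mul,
    mul_div_cancel₀ _ h0]
  simp

lemma cost_eq (n : ℕ) (hn : 2 ≤ n) (N : ℕ) (ρ T θ : ℝ) (hT : 0 < T) (x : Fin n → ℝ) (i : Fin n)
    (xb : ℝ) (hxb : xb = (∑ j, x j) / (n : ℝ)) :
    costN n N ρ T θ x i - θ * ∑ k : Fin (N + 1), (xiN n N ρ T θ x i k) ^ 2 =
      (n : ℝ) * xb * (xb * (vN n N ρ T θ ⬝ᵥ LL (aS (ρ * T) N) N *ᵥ vN n N ρ T θ)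
        + (x i - xb) * (wN N ρ T θ ⬝ᵥ LL (aS (ρ * T) N) N *ᵥ vN n N ρ T θ)) := by
  have h0 : (n : ℝ) ≠ 0 := by positivity
  have hs : ∑ j ∈ Finset.univ.erase i, xiN n N ρ T θ x j =
      ((n : ℝ) * xb) • vN n N ρ T θ - xiN n N ρ T θ x i := by
    rw [eq_sub_iff_add_eq, Finset.sum_erase_add _ _ (mem_univ i), xi_sum n hn, hxb,
      mul_div_cancel₀ _ h0]
  have hx : xiN n N ρ T θ x i = xb • vN n N ρ T θ + (x i - xb) • wN N ρ T θ := by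
    rw [hxb]; rfl
  have hq : ∑ k : Fin (N + 1), (xiN n N ρ T θ x i k) ^ 2 =
      xiN n N ρ T θ x i ⬝ᵥ xiN n N ρ T θ x i := by
    simp only [dotProduct, pow_two]
  have ht : ∀ ξ : Fin (N + 1) → ℝ, ξ ⬝ᵥ (LL (aS (ρ * T) N) N)ᵀ *ᵥ ξ =
      ξ ⬝ᵥ LL (aS (ρ * T) N) N *ᵥ ξ := by
    intro ξ
    rw [Matrix.mulVec_transpose, dotProduct_comm, ← Matrix.dotProduct_mulVec]
  have key : costN n N ρ T θ x i - θ * ∑ k : Fin (N + 1), (xiN n N ρ T θ x i k) ^ 2 =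
      (n : ℝ) * xb * (xiN n N ρ T θ x i ⬝ᵥ LL (aS (ρ * T) N) N *ᵥ vN n N ρ T θ) := by
    rw [hq, costN, hs, Gam_eq ρ T θ hT, GamT_eq, ← aS]
    simp only [Matrix.add_mulVec, dotProduct_add, Matrix.smul_mulVec, Matrix.one_mulVec,
      dotProduct_smul, smul_eq_mul, Matrix.mulVec_sub, dotProduct_sub, Matrix.mulVec_smul, ht]
    ring
  rw [key, hx]
  simp only [add_dotProduct, smul_dotProduct, smul_eq_mul]

/-- Convergence of the discrete impact costs
`𝓘_N(i) = C_N(i) − θ Σ_k (ξ^{(N)}_{i,k})²` to the continuous impact cost `𝓘`. -/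
theorem stmt14 (n : ℕ) (hn : 2 ≤ n) (ρ T θ : ℝ) (hρ : 0 < ρ) (hT : 0 < T) (hθ : 0 < θ)
    (x : Fin n → ℝ) (xb : ℝ) (hxb : xb = (∑ j, x j) / (n : ℝ))
    (E D : ℝ)
    (hE : E = Real.exp (ρ * T * ((n : ℝ) + 1) / ((n : ℝ) - 1)))
    (hD : D = (n : ℝ) * ((ρ * T + 1) * ((n : ℝ) + 1) + 2) * E - ((n : ℝ) - 1)) :
    ∀ i : Fin n,
      Tendsto
        (fun N : ℕ =>
          costN n N ρ T θ x i - θ * ∑ k : Fin (N + 1), (xiN n N ρ T θ x i k) ^ 2)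
        atTop
        (nhds
          (((n : ℝ) / (ρ * T + 1)) * xb * (x i - xb)
            + xb ^ 2 * (n : ℝ) ^ 3 * ((n : ℝ) + 1) *
                (((ρ * T + 1 / 2) * ((n : ℝ) + 1) + 3) * E ^ 2
                  - (2 * ((n : ℝ) - 1) / (n : ℝ) ^ 2) * ((n : ℝ) * E + 1 / 4)) / D ^ 2)) := by
  intro i
  set p : ℝ := (n : ℝ) with hpn
  have hp : 1 < p := by
    have : (2 : ℝ) ≤ n := by exact_mod_cast hn
    linarith
  set b : ℝ := ρ * T with hbdef
  have hb : 0 < b := mul_pos hρ hT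
  have hEpos : 0 < E := by rw [hE]; exact Real.exp_pos _
  have hν : ∀ N, AA p θ (aS b N) N *ᵥ nuN n N ρ T θ = 1 := by
    intro N
    rw [nuN_eq n N ρ T θ hT]
    exact AA_inv p θ _ (by linarith) hθ (aS_pos b N).le (aS_le b hb N) N
  have hω : ∀ᶠ N in atTop, omN N ρ T θ = oS θ (aS b N) N := by
    filter_upwards [eventually_ge_atTop 1] with N hN
    rw [omN_eq N ρ T θ hT]
    exact AA_uniq 0 θ _ le_rfl hθ (aS_pos b N).le (aS_le b hb N) N _
      (oS_eq θ _ hθ (aS_pos b N) (aS_lt b hb N hN) N)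
  obtain ⟨-, h1, h2⟩ := nu_main p θ b hp hθ hb (fun N => nuN n N ρ T θ) hν E hE
  have h3 := onu_lim p θ b hp hθ hb (fun N => nuN n N ρ T θ) hν
  have h4 := osum_lim θ b hθ hb
  have hr1 := rS_lt p θ hp hθ
  have hr2 := rS_gt p θ hp hθ
  have hB : 0 < 2 * θ + (p - 1) / 2 := by linarith
  have hr : 1 - rS p θ = (p - 1) / (2 * θ + (p - 1) / 2) := by
    rw [rS, eq_div_iff hB.ne', sub_mul, div_mul_cancel₀ _ hB.ne']; ring
  have hr' : 1 + rS p θ = 4 * θ / (2 * θ + (p - 1) / 2) := by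
    rw [rS, eq_div_iff hB.ne', add_mul, div_mul_cancel₀ _ hB.ne']; ring
  have hp1 : p - 1 ≠ 0 := by linarith
  have hp2 : p + 1 ≠ 0 := by linarith
  have hp0 : p ≠ 0 := by linarith
  have es : ((1 - rS p θ) * (1 / (p + 1)) * (1 + 1 / (p * E))) * (1 / (1 - rS p θ)) +
        (b / (p + 1) + (1 / (p + 1)) * 2 / ((p + 1) * E) * (E - 1)) = D / (p * (p + 1) ^ 2 * E) := by
    have : 1 - rS p θ ≠ 0 := by linarith
    rw [hD]
    field_simp
    ring
  have em : ((1 - rS p θ) * (1 / (p + 1)) * (1 + 1 / (p * E))) ^ 2 * (1 / (1 - rS p θ ^ 2)) =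
      (p - 1) / (4 * θ) * ((p * E + 1) / (p * (p + 1) * E)) ^ 2 := by
    have e1 : 1 - rS p θ ^ 2 = (1 - rS p θ) * (1 + rS p θ) := by ring
    rw [e1, hr, hr']
    generalize 2 * θ + (p - 1) / 2 = B at *
    field_simp
  rw [es] at h2
  rw [em] at h1
  have hE1 : 1 ≤ E := by
    rw [hE]
    apply Real.one_le_exp
    have : 0 < p - 1 := by linarith
    positivity
  have hDpos : 0 < D := by
    rw [hD]
    have h0 : 0 < p - 1 := by linarith
    have : p * ((b + 1) * (p + 1) + 2) * 1 ≤ p * ((b + 1) * (p + 1) + 2) * E := by gcongr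
    nlinarith [mul_pos hb (by linarith : 0 < p), mul_pos (mul_pos hb (by linarith : 0 < p)) (by linarith : 0 < p + 1)]
  have hS : D / (p * (p + 1) ^ 2 * E) ≠ 0 := by positivity
  have hb1 : b + 1 ≠ 0 := by linarith
  -- the two bilinear terms
  have hvv := ((h2.sub (h1.const_mul (2 * θ))).div ((h2.pow 2).const_mul (p + 1))
    (mul_ne_zero hp2 (pow_ne_zero 2 hS)))
  have hwv := (h2.sub (h3.const_mul (2 * θ))).div (h4.mul h2) (mul_ne_zero hb1 hS)
  have hlim := ((hvv.const_mul xb).add (hwv.const_mul (x i - xb))).const_mul (p * xb)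
  have elim : ∀ F G : ℝ, F = G → nhds F = nhds G := fun F G h => by rw [h]
  refine Tendsto.congr' ?_ (hlim.trans_eq ?_)
  · filter_upwards [hω] with N hN
    rw [cost_eq n hn N ρ T θ hT x i xb hxb]
    have hqv : vN n N ρ T θ ⬝ᵥ LL (aS b N) N *ᵥ vN n N ρ T θ =
        (∑ k, nuN n N ρ T θ k - 2 * θ * (nuN n N ρ T θ ⬝ᵥ nuN n N ρ T θ)) /
          ((p + 1) * (∑ k, nuN n N ρ T θ k) ^ 2) := by
      have q := AA_quad p θ (aS b N) N (nuN n N ρ T θ)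
      rw [hν N, dotProduct_one] at q
      have q' : nuN n N ρ T θ ⬝ᵥ LL (aS b N) N *ᵥ nuN n N ρ T θ =
        (∑ k, nuN n N ρ T θ k - 2 * θ * (nuN n N ρ T θ ⬝ᵥ nuN n N ρ T θ)) / (p + 1) := by
        rw [eq_div_iff hp2]; linarith
      simp only [vN, Matrix.mulVec_smul, dotProduct_smul, smul_dotProduct, smul_eq_mul, q']
      rw [mul_comm (p + 1), ← div_div, div_right_comm, ← mul_assoc, ← pow_two, _root_.one_div_pow]
      ring
    have hqw : wN N ρ T θ ⬝ᵥ LL (aS b N) N *ᵥ vN n N ρ T θ =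
        (∑ k, nuN n N ρ T θ k - 2 * θ * (omN N ρ T θ ⬝ᵥ nuN n N ρ T θ)) /
          ((∑ k, omN N ρ T θ k) * (∑ k, nuN n N ρ T θ k)) := by
      have hO : AA 0 θ (aS b N) N *ᵥ omN N ρ T θ = 1 := by
        rw [omN_eq N ρ T θ hT]
        exact AA_inv 0 θ _ le_rfl hθ (aS_pos b N).le (aS_le b hb N) N
      have q' : omN N ρ T θ ⬝ᵥ LL (aS b N) N *ᵥ nuN n N ρ T θ =
          ∑ k, nuN n N ρ T θ k - 2 * θ * (omN N ρ T θ ⬝ᵥ nuN n N ρ T θ) := by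
        have q : (AA 0 θ (aS b N) N *ᵥ omN N ρ T θ) ⬝ᵥ nuN n N ρ T θ = ∑ k, nuN n N ρ T θ k := by
          rw [hO, one_dotProduct]
        rw [← q]
        simp only [AA, zero_smul, add_zero, Matrix.add_mulVec, add_dotProduct, Matrix.smul_mulVec,
          Matrix.one_mulVec, smul_dotProduct, smul_eq_mul, Matrix.mulVec_transpose]
        rw [Matrix.dotProduct_mulVec]
        ring
      simp only [vN, wN, Matrix.mulVec_smul, dotProduct_smul, smul_dotProduct, smul_eq_mul, q']
      rw [← div_div]
      ring
    rw [← hbdef, hqv, hqw]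
    simp only [Pi.div_apply]
    rw [← hN]
  · apply elim
    simp only [mul_zero, sub_zero]
    have hD0 := hDpos.ne'
    have e1 : D / (p * (p + 1) ^ 2 * E) / ((b + 1) * (D / (p * (p + 1) ^ 2 * E))) = 1 / (b + 1) := by
      rw [div_mul_eq_div_div_swap, div_self hS]
    rw [e1]
    have e2 : (D / (p * (p + 1) ^ 2 * E) -
        2 * θ * ((p - 1) / (4 * θ) * ((p * E + 1) / (p * (p + 1) * E)) ^ 2)) /
        ((p + 1) * (D / (p * (p + 1) ^ 2 * E)) ^ 2) =
        (p + 1) * (p * E * D - (p - 1) / 2 * (p * E + 1) ^ 2) / D ^ 2 := by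
      clear_value p b
      clear hD
      field_simp
      ring
    rw [e2]
    have e3 : p * E * D - (p - 1) / 2 * (p * E + 1) ^ 2 = p ^ 2 * (((b + 1 / 2) * (p + 1) + 3) * E ^ 2
                  - (2 * (p - 1) / p ^ 2) * (p * E + 1 / 4)) := by
      rw [hD]; field_simp; ring
    rw [e3]
    ring
end
end

section
/- Let n ≥ 2 be an integer, ρ > 0, T > 0, θ = 0, and x_1,…,x_n ∈ ℝ with mean x̄. For each N ≥ 2 let ξ^{(N)}_i := x̄·v^{(N)} + (x_i − x̄)·w^{(N)} be the equilibrium strategy on the equidistant N-step grid and C_N(i) := (1/2)·(ξ^{(N)}_i)^⊤ Γ^0 ξ^{(N)}_i + (ξ^{(N)}_i)^⊤ Γ̃ (Σ_{j≠i} ξ^{(N)}_j) the equilibrium execution cost. Then, with 𝔡₁ := n·e^{2ρT(n+1)/(n−1)}((n+1)ρT + n + 3) + (n−1)²·e^{ρT(n+1)/(n−1)} + (n+1)ρT + 3n + 1 and 𝔡₂ := n·e^{2ρT(n+1)/(n−1)}((n+1)ρT + n + 3) + (1−n²)·e^{ρT(n+1)/(n−1)} − (n+1)ρT − 3n − 1,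 one has lim_{N→∞} C_{2N}(i) = n·x̄²·((n+1)n·e^{2ρT(n+1)/(n−1)} + n + 1)/𝔡₁ + n·x̄·(x_i − x̄)/(e^{−ρT} + ρT + 1) and lim_{N→∞} C_{2N+1}(i) = n·x̄²·((n+1)n·e^{2ρT(n+1)/(n−1)} − n − 1)/𝔡₂ + n·x̄·(x_i − x̄)/(ρT + 1 − e^{−ρT}). -/
open Matrix Finset Filter

noncomputable section

/-- `𝔡₁`. -/
def frakd1 (n : ℕ) (ρ T : ℝ) : ℝ :=
  (n : ℝ) * Real.exp (2 * ρ * T * ((n : ℝ) + 1) / ((n : ℝ) - 1)) *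
      (((n : ℝ) + 1) * ρ * T + (n : ℝ) + 3)
    + ((n : ℝ) - 1) ^ 2 * Real.exp (ρ * T * ((n : ℝ) + 1) / ((n : ℝ) - 1))
    + ((n : ℝ) + 1) * ρ * T + 3 * (n : ℝ) + 1

/-- `𝔡₂`. -/
def frakd2 (n : ℕ) (ρ T : ℝ) : ℝ :=
  (n : ℝ) * Real.exp (2 * ρ * T * ((n : ℝ) + 1) / ((n : ℝ) - 1)) *
      (((n : ℝ) + 1) * ρ * T + (n : ℝ) + 3)
    + (1 - (n : ℝ) ^ 2) * Real.exp (ρ * T * ((n : ℝ) + 1) / ((n : ℝ) - 1))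
    - ((n : ℝ) + 1) * ρ * T - 3 * (n : ℝ) - 1

lemma aux_quad (a : ℝ) (f : ℕ → ℝ) (L : ℕ → ℝ) (h0 : L 0 = 0)
    (hL : ∀ i, L (i + 1) = a * (L i + f i)) (m : ℕ) :
    2 * ∑ i ∈ range m, f i * (f i / 2 + L i)
      = (1 - a ^ 2) * ∑ i ∈ range m, (L i + f i) ^ 2 + L m ^ 2 := by
  induction m with
  | zero => simp [h0]
  | succ m ih =>
    rw [sum_range_succ, sum_range_succ, mul_add, ih, hL]
    ring

lemma aux_L (a : ℝ) (f : ℕ → ℝ) (i : ℕ) :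
    ∑ j ∈ range (i + 1), a ^ (i + 1 - j) * f j
      = a * (∑ j ∈ range i, a ^ (i - j) * f j + f i) := by
  rw [sum_range_succ, mul_add, mul_sum]
  congr 1
  · apply sum_congr rfl
    intro j hj
    have := mem_range.1 hj
    rw [show i + 1 - j = (i - j) + 1 by omega, pow_succ]; ring
  · simp

def aN (ρ T : ℝ) (N : ℕ) : ℝ := Real.exp (-(ρ * T / N))

lemma aux_exp (ρ T : ℝ) (N : ℕ) (i j : Fin (N + 1)) (h : j ≤ i) :
    Real.exp (-(ρ * (egrid T N i - egrid T N j))) = aN ρ T N ^ (i.val - j.val) := by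
  unfold aN egrid
  rw [← Real.exp_nat_mul, Nat.cast_sub h]
  congr 1; ring

lemma aux_G_lower (ρ T : ℝ) (N : ℕ) (f : ℕ → ℝ) (i : Fin (N + 1)) :
    (GamT ρ (egrid T N)).mulVec (fun k => f k.val) i
      = f i / 2 + ∑ j ∈ range i.val, aN ρ T N ^ (i.val - j) * f j := by
  have h1 : (GamT ρ (egrid T N)).mulVec (fun k => f k.val) i
      = ∑ j : Fin (N + 1), (fun j : ℕ => if i.val < j then 0 else if i.val = j then f j / 2 else
          aN ρ T N ^ (i.val - j) * f j) j.val := by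
    unfold Matrix.mulVec dotProduct
    apply sum_congr rfl
    intro j _
    simp only [GamT, Matrix.of_apply, Fin.lt_def, Fin.ext_iff]
    split_ifs with h h'
    · simp
    · ring
    · rw [aux_exp ρ T N i j (by rw [Fin.le_def]; omega)]
  rw [h1, Fin.sum_univ_eq_sum_range (fun j : ℕ => if i.val < j then 0 else if i.val = j then f j / 2 else
          aN ρ T N ^ (i.val - j) * f j)]
  obtain ⟨m, hm⟩ : ∃ m, N + 1 = i.val + 1 + m := ⟨N - i.val, by omega⟩
  rw [congrArg range hm, sum_range_add, sum_range_succ, add_comm (f i / 2)]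
  have h2 : ∑ x ∈ range m, (if i.val < i.val + 1 + x then 0 else
      if i.val = i.val + 1 + x then f (i.val + 1 + x) / 2 else
          aN ρ T N ^ (i.val - (i.val + 1 + x)) * f (i.val + 1 + x)) = 0 := by
    apply sum_eq_zero
    intro x _
    rw [if_pos (by omega)]
  rw [h2]
  simp only [lt_irrefl, if_false, if_true, add_zero]
  congr 1
  apply sum_congr rfl
  intro j hj
  have := mem_range.1 hj
  rw [if_neg (by omega), if_neg (by omega)]

lemma aux_G_upper (ρ T : ℝ) (N : ℕ) (f : ℕ → ℝ) (i : Fin (N + 1)) :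
    (GamT ρ (egrid T N))ᵀ.mulVec (fun k => f k.val) i
      = f i / 2 + ∑ x ∈ range (N - i.val), aN ρ T N ^ (x + 1) * f (i.val + 1 + x) := by
  have h1 : (GamT ρ (egrid T N))ᵀ.mulVec (fun k => f k.val) i
      = ∑ j : Fin (N + 1), (fun j : ℕ => if j < i.val then 0 else if j = i.val then f j / 2 else
          aN ρ T N ^ (j - i.val) * f j) j.val := by
    unfold Matrix.mulVec dotProduct
    apply sum_congr rfl
    intro j _
    simp only [GamT, Matrix.of_apply, Fin.lt_def, Fin.ext_iff, Matrix.transpose_apply]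
    split_ifs with h h'
    · simp
    · ring
    · rw [aux_exp ρ T N j i (by rw [Fin.le_def]; omega)]
  rw [h1, Fin.sum_univ_eq_sum_range (fun j : ℕ => if j < i.val then 0 else if j = i.val then f j / 2 else
          aN ρ T N ^ (j - i.val) * f j)]
  obtain ⟨m, hm⟩ : ∃ m, N + 1 = i.val + 1 + m := ⟨N - i.val, by omega⟩
  rw [show N - i.val = m by omega, congrArg range hm, sum_range_add, sum_range_succ]
  have h2 : ∑ j ∈ range i.val, (if j < i.val then 0 else if j = i.val then f j / 2 else
          aN ρ T N ^ (j - i.val) * f j) = 0 := by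
    apply sum_eq_zero
    intro x hx
    rw [if_pos (mem_range.1 hx)]
  rw [h2]
  simp only [lt_irrefl, if_false, if_true, zero_add]
  congr 1
  apply sum_congr rfl
  intro j hj
  rw [if_neg (by omega), if_neg (by omega), show i.val + 1 + j - i.val = j + 1 by omega]

lemma aux_Gam (ρ T : ℝ) (hT : 0 < T) (N : ℕ) :
    Gam ρ 0 (egrid T N) = GamT ρ (egrid T N) + (GamT ρ (egrid T N))ᵀ := by
  have key : ∀ i j : Fin (N + 1), j ≤ i → egrid T N j ≤ egrid T N i := by
    intro i j h
    have : (j.val : ℝ) ≤ i.val := by exact_mod_cast h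
    unfold egrid
    gcongr
  ext i j
  simp only [Gam, GamT, Matrix.add_apply, Matrix.of_apply, Matrix.transpose_apply]
  rcases lt_trichotomy i j with h | h | h
  · have := key j i h.le
    rw [abs_of_nonpos (by linarith)]
    simp [h, h.ne, h.ne', h.not_gt]
  · subst h; simp; norm_num
  · have := key i j h.le
    rw [abs_of_nonneg (by linarith)]
    simp [h, h.ne', h.not_gt]

lemma aux_pos (ρ T : ℝ) (hρ : 0 < ρ) (hT : 0 < T) (N : ℕ) (hN : 0 < N) (x : Fin (N + 1) → ℝ)
    (hx : x ⬝ᵥ (GamT ρ (egrid T N)).mulVec x = 0) : x = 0 := by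
  let f : ℕ → ℝ := fun k => if h : k < N + 1 then x ⟨k, h⟩ else 0
  have hf : x = fun k => f k.val := by
    ext k
    simp only [f]
    rw [dif_pos k.2]
  set a := aN ρ T N with ha
  have ha0 : 0 < a := Real.exp_pos _
  have ha1 : a < 1 := by
    rw [ha, aN, Real.exp_lt_one_iff]
    have : (0 : ℝ) < N := by exact_mod_cast hN
    have : 0 < ρ * T / N := by positivity
    linarith
  let L : ℕ → ℝ := fun i => ∑ j ∈ range i, a ^ (i - j) * f j
  have hL0 : L 0 = 0 := by simp [L]
  have hL : ∀ i, L (i + 1) = a * (L i + f i) := fun i => aux_L a f i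
  have hsum : ∑ i ∈ range (N + 1), f i * (f i / 2 + L i) = 0 := by
    rw [← hx, hf]
    unfold dotProduct
    simp only [aux_G_lower]
    rw [← Fin.sum_univ_eq_sum_range (fun i => f i * (f i / 2 + L i))]
  have hq := aux_quad a f L hL0 hL (N + 1)
  rw [hsum] at hq
  have h1 : 0 < 1 - a ^ 2 := by nlinarith
  have h2 : 0 ≤ ∑ i ∈ range (N + 1), (L i + f i) ^ 2 := sum_nonneg fun i _ => sq_nonneg _
  have h3 : ∑ i ∈ range (N + 1), (L i + f i) ^ 2 = 0 := by
    nlinarith [sq_nonneg (L (N + 1)), mul_nonneg h1.le h2]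
  have h4 : ∀ i, i < N + 1 → L i + f i = 0 := by
    intro i hi
    have := (sum_eq_zero_iff_of_nonneg (fun i _ => sq_nonneg (L i + f i))).1 h3 i (mem_range.2 hi)
    exact pow_eq_zero_iff (two_ne_zero) |>.1 this
  have h5 : ∀ i, i < N + 1 → L i = 0 := by
    intro i hi
    cases i with
    | zero => exact hL0
    | succ i => rw [hL, h4 i (by omega), mul_zero]
  rw [hf]
  ext k
  have := h4 k k.2
  rw [h5 k k.2] at this
  simpa using this

lemma aux_unit {m : ℕ} (M : Matrix (Fin m) (Fin m) ℝ)
    (h : ∀ x, x ⬝ᵥ M.mulVec x = 0 → x = 0) : IsUnit M.det := by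
  rw [isUnit_iff_ne_zero]
  intro hd
  obtain ⟨v, hv, hv0⟩ := Matrix.exists_mulVec_eq_zero_iff.2 hd
  exact hv (h v (by rw [hv0]; simp))

lemma aux_tr {m : ℕ} (G : Matrix (Fin m) (Fin m) ℝ) (x y : Fin m → ℝ) :
    x ⬝ᵥ Gᵀ.mulVec y = y ⬝ᵥ G.mulVec x := by
  rw [Matrix.mulVec_transpose, dotProduct_comm, Matrix.dotProduct_mulVec]

lemma aux_inv {m : ℕ} (M : Matrix (Fin m) (Fin m) ℝ) (h : IsUnit M.det) (y b : Fin m → ℝ)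
    (hy : M.mulVec y = b) : M⁻¹.mulVec b = y := by
  rw [← hy, Matrix.mulVec_mulVec, Matrix.nonsing_inv_mul _ h, Matrix.one_mulVec]

lemma aux_inv' {m : ℕ} (M : Matrix (Fin m) (Fin m) ℝ) (h : IsUnit M.det) (b : Fin m → ℝ) :
    M.mulVec (M⁻¹.mulVec b) = b := by
  rw [Matrix.mulVec_mulVec, Matrix.mul_nonsing_inv _ h, Matrix.one_mulVec]

lemma aux_alg {m : ℕ} (G : Matrix (Fin m) (Fin m) ℝ) (v w : Fin m → ℝ) (n c d xb δ : ℝ)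
    (hn : n + 1 ≠ 0)
    (hv : (n • G + Gᵀ).mulVec v = c • 1) (hs : ∑ k, v k = 1) (hw : Gᵀ.mulVec w = d • 1) :
    (1 / 2) * ((xb • v + δ • w) ⬝ᵥ (G + Gᵀ).mulVec (xb • v + δ • w))
      + (xb • v + δ • w) ⬝ᵥ G.mulVec (((n - 1) * xb) • v - δ • w)
      = n * xb ^ 2 * c / (n + 1) + n * xb * δ * d := by
  have h1 : (n + 1) * (v ⬝ᵥ G.mulVec v) = c := by
    have := congrArg (fun y => v ⬝ᵥ y) hv
    simp only [Matrix.add_mulVec, Matrix.smul_mulVec, dotProduct_add, dotProduct_smul, aux_tr,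
      dotProduct_one, hs, smul_eq_mul] at this
    linarith
  have h2 : w ⬝ᵥ G.mulVec v = d := by
    rw [← aux_tr, hw, dotProduct_smul, dotProduct_one, hs]; simp
  simp only [Matrix.add_mulVec, Matrix.mulVec_add, Matrix.mulVec_sub, Matrix.mulVec_smul,
    dotProduct_add, add_dotProduct, dotProduct_sub, dotProduct_smul, smul_dotProduct, aux_tr,
    smul_eq_mul]
  rw [h2, ← h1]
  field_simp
  ring

lemma geo_lower (a z : ℝ) (i : ℕ) :
    (∑ j ∈ range i, a ^ (i - j) * z ^ j) * (z - a) = a * (z ^ i - a ^ i) := by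
  induction i with
  | zero => simp
  | succ i ih =>
    rw [aux_L a (fun j => z ^ j), mul_assoc, add_mul, ih]
    ring

lemma geo_upper (a z : ℝ) (i m : ℕ) :
    (∑ x ∈ range m, a ^ (x + 1) * z ^ (i + 1 + x)) * (1 - a * z)
      = a * z ^ (i + 1) * (1 - (a * z) ^ m) := by
  induction m with
  | zero => simp
  | succ m ih =>
    rw [sum_range_succ, add_mul, ih]
    ring

def symz (n a z : ℝ) : ℝ := n * (a / (z - a)) + (n + 1) / 2 + a * z / (1 - a * z)

lemma aux_z (n a z : ℝ) (i m : ℕ) (h1 : z - a ≠ 0) (h2 : 1 - a * z ≠ 0) :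
    n * (z ^ i / 2 + ∑ j ∈ range i, a ^ (i - j) * z ^ j)
      + (z ^ i / 2 + ∑ x ∈ range m, a ^ (x + 1) * z ^ (i + 1 + x))
      = symz n a z * z ^ i - n * a ^ (i + 1) * (1 / (z - a))
        - a ^ (m + 1) * (z ^ (i + m + 1) / (1 - a * z)) := by
  have e1 := eq_div_of_mul_eq h1 (geo_lower a z i)
  have e2 := eq_div_of_mul_eq h2 (geo_upper a z i m)
  rw [e1, e2, symz]
  field_simp
  ring

lemma aux_nu (n ρ T : ℝ) (N : ℕ) (a c A B l u : ℝ) (ha : a = aN ρ T N)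
    (h11 : 1 - a ≠ 0) (hl1 : l - a ≠ 0) (hl2 : 1 - a * l ≠ 0)
    (hu1 : u - a ≠ 0) (hu2 : 1 - a * u ≠ 0)
    (hc : c * symz n a 1 = 1) (hl : symz n a l = 0) (hu : symz n a u = 0)
    (hb1 : c * (1 / (1 - a)) + A * (1 / (l - a)) + B * (1 / (u - a)) = 0)
    (hb2 : c * (1 / (1 - a)) + A * (l ^ (N + 1) / (1 - a * l)) +
      B * (u ^ (N + 1) / (1 - a * u)) = 0) :
    (n • GamT ρ (egrid T N) + (GamT ρ (egrid T N))ᵀ).mulVec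
      (fun k => c + A * l ^ k.val + B * u ^ k.val) = 1 := by
  ext i
  rw [Matrix.add_mulVec, Matrix.smul_mulVec, Pi.add_apply, Pi.smul_apply,
    aux_G_lower ρ T N (fun k => c + A * l ^ k + B * u ^ k),
    aux_G_upper ρ T N (fun k => c + A * l ^ k + B * u ^ k), ← ha]
  obtain ⟨m, hm⟩ : ∃ m, N = i.val + m := ⟨N - i.val, by omega⟩
  rw [show N - i.val = m by omega]
  rw [show N + 1 = i.val + m + 1 by omega] at hb2
  have z1 := aux_z n a 1 i m h11 (by simpa using h11)
  have zl := aux_z n a l i m hl1 hl2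
  have zu := aux_z n a u i m hu1 hu2
  rw [hl] at zl
  rw [hu] at zu
  simp only [one_pow, mul_one] at z1
  simp only [mul_add, sum_add_distrib, smul_eq_mul, Pi.one_apply]
  have s1 : ∀ (s : Finset ℕ) (g h : ℕ → ℝ) (K : ℝ),
      ∑ x ∈ s, g x * (K * h x) = K * ∑ x ∈ s, g x * h x := by
    intro s g h K; rw [mul_sum]; apply sum_congr rfl; intros; ring
  have s0 : ∀ (s : Finset ℕ) (g : ℕ → ℝ) (K : ℝ),
      ∑ x ∈ s, g x * K = K * ∑ x ∈ s, g x := by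
    intro s g K; rw [mul_sum]; apply sum_congr rfl; intros; ring
  simp only [s1]
  rw [s0 _ (fun j => a ^ (i.val - j)), s0 _ (fun j => a ^ (j + 1))]
  linear_combination c * z1 + A * zl + B * zu + hc - n * a ^ (i.val + 1) * hb1
    - a ^ (m + 1) * hb2

lemma aux_om (ρ T : ℝ) (N : ℕ) (a c D z : ℝ) (ha : a = aN ρ T N) (ha0 : 0 < a)
    (h11 : 1 - a ≠ 0) (hc : c = 2 * (1 - a) / (1 + a)) (hz : z = -a⁻¹)
    (hD : D = 4 * a * (-a) ^ N / (1 + a)) :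
    (GamT ρ (egrid T N))ᵀ.mulVec (fun k => c + D * z ^ k.val) = 1 := by
  ext i
  rw [aux_G_upper ρ T N (fun k => c + D * z ^ k), ← ha]
  obtain ⟨m, hm⟩ : ∃ m, N = i.val + m := ⟨N - i.val, by omega⟩
  rw [show N - i.val = m by omega]
  have haz : a * z = -1 := by rw [hz]; field_simp
  have z1 := eq_div_of_mul_eq (by simpa using h11) (geo_upper a 1 i m)
  have zl := eq_div_of_mul_eq (by rw [haz]; norm_num) (geo_upper a z i m)
  simp only [one_pow, mul_one] at z1
  simp only [mul_add, sum_add_distrib, Pi.one_apply]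
  have s1 : ∀ (s : Finset ℕ) (g h : ℕ → ℝ) (K : ℝ),
      ∑ x ∈ s, g x * (K * h x) = K * ∑ x ∈ s, g x * h x := by
    intro s g h K; rw [mul_sum]; apply sum_congr rfl; intros; ring
  have s0 : ∀ (s : Finset ℕ) (g : ℕ → ℝ) (K : ℝ),
      ∑ x ∈ s, g x * K = K * ∑ x ∈ s, g x := by
    intro s g K; rw [mul_sum]; apply sum_congr rfl; intros; ring
  rw [s1, s0 _ (fun j => a ^ (j + 1)), z1, zl, haz]
  have e1 : a * z ^ (i.val + 1) = - z ^ i.val := by rw [pow_succ]; linear_combination z ^ i.val * haz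
  rw [e1]
  have e2 : (-a) ^ N * z ^ i.val = (-a) ^ m := by
    have : (-a) * z = 1 := by linarith
    have hh : (-a) ^ N = (-a) ^ (i.val + m) := congrArg _ hm
    rw [hh, pow_add, mul_comm, ← mul_assoc, ← mul_pow, mul_comm z, this]; simp
  have e3 : D * z ^ i.val = 4 * a * (-a) ^ m / (1 + a) := by
    rw [hD, ← e2]; ring
  have e4 : D * z ^ i.val * (-1) ^ m = 4 * a * a ^ m / (1 + a) := by
    have : a ^ m = (-a) ^ m * (-1) ^ m := by rw [← mul_pow]; simp
    rw [e3, this]; ring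
  have hp : 1 + a ≠ 0 := by positivity
  have e5 : c / 2 + c * (a * (1 - a ^ m) / (1 - a)) + 2 * a * a ^ m / (1 + a) = 1 := by
    rw [hc]; field_simp; ring
  linear_combination e5 + e4 / 2

lemma aux_sum_om (ρ T : ℝ) (hρ : 0 < ρ) (hT : 0 < T) (N : ℕ) (hN : 0 < N) :
    ∑ k, omN N ρ T 0 k = (N + 1) * (2 * (1 - aN ρ T N) / (1 + aN ρ T N)) +
      4 * aN ρ T N * (1 - (-1) ^ (N + 1) * aN ρ T N ^ (N + 1)) / (1 + aN ρ T N) ^ 2 := by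
  set a := aN ρ T N with ha
  have ha0 : 0 < a := Real.exp_pos _
  have ha1 : a < 1 := by
    rw [ha, aN, Real.exp_lt_one_iff]
    have : (0 : ℝ) < N := by exact_mod_cast hN
    have : 0 < ρ * T / N := by positivity
    linarith
  have h := aux_om ρ T N a _ _ _ ha ha0 (by linarith) rfl rfl rfl
  have hu : IsUnit ((GamT ρ (egrid T N))ᵀ).det := by
    apply aux_unit
    intro x hx
    rw [aux_tr] at hx
    exact aux_pos ρ T hρ hT N hN x hx
  have h2 := aux_inv _ hu _ _ h
  have : omN N ρ T 0 = (GamT ρ (egrid T N))ᵀ⁻¹.mulVec 1 := by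
    rw [omN, aux_Gam ρ T hT]; simp
  rw [this, h2, Fin.sum_univ_eq_sum_range (fun k => 2 * (1 - a) / (1 + a) +
    4 * a * (-a) ^ N / (1 + a) * (-a⁻¹) ^ k), sum_add_distrib, ← mul_sum,
    geom_sum_eq (by have := inv_pos.2 ha0; linarith)]
  simp only [sum_const, card_range, nsmul_eq_mul, Nat.cast_add, Nat.cast_one]
  congr 1
  have e : (-a) ^ N * (-a⁻¹) ^ (N + 1) = -a⁻¹ := by
    rw [pow_succ, ← mul_assoc, ← mul_pow, show (-a) * (-a⁻¹) = 1 by field_simp]; simp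
  have hp : 1 + a ≠ 0 := by positivity
  have hp2 : -a⁻¹ - 1 ≠ 0 := by have := inv_pos.2 ha0; linarith
  have e' : (-1) ^ (N + 1) * a ^ (N + 1) = (-a) ^ (N + 1) := by rw [← mul_pow]; simp
  rw [e', mul_div_assoc', div_mul_eq_mul_div, mul_sub, mul_assoc (4 * a), e]
  have hp3 : -a⁻¹ - 1 = -(1 + a) / a := by field_simp; ring
  rw [hp3]
  field_simp
  ring

def lN (n ρ T : ℝ) (N : ℕ) : ℝ :=
  Real.exp (Real.arsinh ((n + 1) / (n - 1) * Real.sinh (ρ * T / N)))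

def cF (n a : ℝ) : ℝ := 2 / ((n + 1) * (1 + a))
def pF (a l : ℝ) : ℝ := (1 - a) / (l - a)
def qF (a l : ℝ) : ℝ := (1 - a) / (1 - a * l)
def rF (a l : ℝ) : ℝ := l / (1 + a * l)
def rF2 (a l : ℝ) : ℝ := l / (l + a)
def DF (p q r r' P s : ℝ) : ℝ := p * (s * P⁻¹) * r' + r * P * q
def AF (c p q r r' P s : ℝ) : ℝ := (-(c * (s * P⁻¹) * r') - r * c) / DF p q r r' P s
def BF (c p q r r' P s : ℝ) : ℝ := (-(p * c) + c * P * q) / DF p q r r' P s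
def SF (m c p q r r' P s e f : ℝ) : ℝ :=
  m * c + AF c p q r r' P s * e * (P - 1) + BF c p q r r' P s * (1 - s * P⁻¹) / f

lemma aux_symz (n a l : ℝ) (h1 : l - a ≠ 0) (h2 : 1 - a * l ≠ 0)
    (hq : a * (n - 1) * (l ^ 2 - 1) = (n + 1) * (1 - a ^ 2) * l) : symz n a l = 0 := by
  unfold symz
  field_simp
  linear_combination -hq

lemma aux_sum_nu_gen (n ρ T : ℝ) (N : ℕ) (a l : ℝ) (ha : a = aN ρ T N) (hn : 1 < n)
    (ha0 : 0 < a) (ha1 : a < 1) (hl : 1 < l)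
    (hq : a * (n - 1) * (l ^ 2 - 1) = (n + 1) * (1 - a ^ 2) * l)
    (hD : DF (pF a l) (qF a l) (rF a l) (rF2 a l) (l ^ (N + 1)) ((-1) ^ (N + 1)) ≠ 0) :
    ∃ y : Fin (N + 1) → ℝ, (n • GamT ρ (egrid T N) + (GamT ρ (egrid T N))ᵀ).mulVec y = 1 ∧
      ∑ k, y k = SF ((N + 1) * (1 - a)) (cF n a) (pF a l) (qF a l) (rF a l) (rF2 a l)
        (l ^ (N + 1)) ((-1) ^ (N + 1)) ((1 - a) / (l - 1)) (1 + l⁻¹) := by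
  have hl0 : 0 < l := by linarith
  have h1a : 1 - a ≠ 0 := by linarith
  have hla : l - a ≠ 0 := by linarith
  have hal : 1 - a * l ≠ 0 := by
    intro h
    have h3 : (l - a) * 2 = 0 := by
      have e : a * l = 1 := by linarith
      have e1 : a * (l ^ 2 - 1) = l - a := by linear_combination l * e
      have e2 : (1 - a ^ 2) * l = l - a := by linear_combination -a * e
      linear_combination -hq + (n - 1) * e1 - (n + 1) * e2
    apply hla; linarith
  have hli : 0 < l⁻¹ := inv_pos.2 hl0
  have hua : -l⁻¹ - a ≠ 0 := by linarith
  have hau : 1 - a * (-l⁻¹) ≠ 0 := by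
    have := mul_pos ha0 hli
    linarith
  have hPu : (-l⁻¹) ^ (N + 1) = (-1) ^ (N + 1) * (l ^ (N + 1))⁻¹ := by
    rw [← inv_pow, ← mul_pow]; simp
  set P := l ^ (N + 1) with hP
  set s : ℝ := (-1) ^ (N + 1) with hs
  set p := pF a l with hp
  set q := qF a l with hqq
  set r := rF a l with hr
  set r' := rF2 a l with hr'
  set c := cF n a with hc
  set A := AF c p q r r' P s with hA
  set B := BF c p q r r' P s with hB
  have E1 : c + A * p - B * r = 0 := by
    rw [hA, hB, AF, BF]; field_simp; unfold DF; ring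
  have E2 : c + A * P * q + B * (s * P⁻¹) * r' = 0 := by
    rw [hA, hB, AF, BF]
    field_simp; unfold DF; ring
  have f1 : (1 - a) * (1 / (l - a)) = p := by rw [hp, pF]; ring
  have f2 : 1 / (-l⁻¹ - a) = -r := by
    have : 0 < 1 + a * l := by positivity
    rw [hr, rF, show -l⁻¹ - a = -((1 + a * l) / l) by field_simp; ring]
    field_simp
  have f3 : (1 - a) * (P / (1 - a * l)) = P * q := by rw [hqq, qF]; ring
  have f4 : 1 / (1 - a * (-l⁻¹)) = r' := by
    rw [hr', rF2, show 1 - a * (-l⁻¹) = (l + a) / l by field_simp; ring]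
    field_simp
  have f5 : (1 - a) * (1 / (1 - a)) = 1 := by field_simp
  refine ⟨fun k => (1 - a) * c + (1 - a) * A * l ^ k.val + B * (-l⁻¹) ^ k.val, ?_, ?_⟩
  · apply aux_nu n ρ T N a _ _ _ l (-l⁻¹) ha h1a hla hal hua hau
    · rw [hc, cF, symz]
      have : n + 1 ≠ 0 := by linarith
      have : 1 + a ≠ 0 := by positivity
      simp only [mul_one]
      field_simp
      ring
    · exact aux_symz n a l hla hal hq
    · apply aux_symz n a _ hua hau
      field_simp
      linear_combination -hq
    · linear_combination E1 + c * f5 + A * f1 + B * f2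
    · rw [hPu, ← hP]
      linear_combination E2 + c * f5 + A * f3 + B * (s * P⁻¹) * f4
  · rw [Fin.sum_univ_eq_sum_range (fun k => (1 - a) * c + (1 - a) * A * l ^ k + B * (-l⁻¹) ^ k),
      sum_add_distrib, sum_add_distrib, ← mul_sum _ (fun k => l ^ k), ← mul_sum _ (fun k => (-l⁻¹) ^ k),
      geom_sum_eq (show l ≠ 1 by linarith),
      geom_sum_eq (show -l⁻¹ ≠ 1 by linarith), hPu, ← hP]
    simp only [sum_const, card_range, nsmul_eq_mul, Nat.cast_add, Nat.cast_one]
    rw [SF, ← hA, ← hB, show -l⁻¹ - 1 = -(1 + l⁻¹) by ring, div_neg]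
    ring

lemma aux_apos (ρ T : ℝ) (N : ℕ) : 0 < aN ρ T N := Real.exp_pos _

lemma aux_alt (ρ T : ℝ) (hρ : 0 < ρ) (hT : 0 < T) (N : ℕ) (hN : 0 < N) : aN ρ T N < 1 := by
  rw [aN, Real.exp_lt_one_iff]
  have : (0 : ℝ) < N := by exact_mod_cast hN
  have : 0 < ρ * T / N := by positivity
  linarith

lemma aux_nuN (n : ℕ) (ρ T : ℝ) (hT : 0 < T) (N : ℕ) :
    Gam ρ 0 (egrid T N) + ((n : ℝ) - 1) • GamT ρ (egrid T N)
      = (n : ℝ) • GamT ρ (egrid T N) + (GamT ρ (egrid T N))ᵀ := by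
  rw [aux_Gam ρ T hT, sub_smul, one_smul]; abel

lemma aux_unit_nu (n : ℕ) (ρ T : ℝ) (hρ : 0 < ρ) (hT : 0 < T) (N : ℕ) (hN : 0 < N) :
    IsUnit ((n : ℝ) • GamT ρ (egrid T N) + (GamT ρ (egrid T N))ᵀ).det := by
  apply aux_unit
  intro x hx
  rw [Matrix.add_mulVec, Matrix.smul_mulVec, dotProduct_add, dotProduct_smul, aux_tr,
    smul_eq_mul] at hx
  apply aux_pos ρ T hρ hT N hN x
  have : (n : ℝ) + 1 ≠ 0 := by positivity
  apply mul_left_cancel₀ this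
  linarith

lemma aux_unit_om (ρ T : ℝ) (hρ : 0 < ρ) (hT : 0 < T) (N : ℕ) (hN : 0 < N) :
    IsUnit ((GamT ρ (egrid T N))ᵀ).det := by
  apply aux_unit
  intro x hx
  rw [aux_tr] at hx
  exact aux_pos ρ T hρ hT N hN x hx

lemma aux_sum_nu (n : ℕ) (hn : 2 ≤ n) (ρ T : ℝ) (hρ : 0 < ρ) (hT : 0 < T) (N : ℕ) (hN : 0 < N)
    (a l : ℝ) (ha : a = aN ρ T N) (hl : l = lN n ρ T N)
    (hD : DF (pF a l) (qF a l) (rF a l) (rF2 a l) (l ^ (N + 1)) ((-1) ^ (N + 1)) ≠ 0) :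
    ∑ k, nuN n N ρ T 0 k = SF ((N + 1) * (1 - a)) (cF n a) (pF a l) (qF a l) (rF a l) (rF2 a l)
        (l ^ (N + 1)) ((-1) ^ (N + 1)) ((1 - a) / (l - 1)) (1 + l⁻¹) := by
  have hn1 : (1 : ℝ) < n := by exact_mod_cast hn
  have hu : 0 < ρ * T / N := by
    have : (0 : ℝ) < N := by exact_mod_cast hN
    positivity
  have hl1 : 1 < l := by
    rw [hl, lN, Real.one_lt_exp_iff, Real.arsinh_pos_iff]
    have := Real.sinh_pos_iff.2 hu
    have : (0 : ℝ) < n - 1 := by linarith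
    positivity
  have ha0 : 0 < a := ha ▸ aux_apos ρ T N
  have hq : a * (n - 1) * (l ^ 2 - 1) = (n + 1) * (1 - a ^ 2) * l := by
    have h1 : l - l⁻¹ = 2 * ((n + 1) / (n - 1) * Real.sinh (ρ * T / N)) := by
      have h0 := Real.sinh_arsinh ((n + 1) / (n - 1) * Real.sinh (ρ * T / N))
      rw [Real.sinh_eq (Real.arsinh _)] at h0
      rw [hl, lN, ← Real.exp_neg]; linear_combination 2 * h0
    have h2 : a⁻¹ - a = 2 * Real.sinh (ρ * T / N) := by
      rw [ha, aN, ← Real.exp_neg, Real.sinh_eq, neg_neg]; ring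
    have h3 : l - l⁻¹ = (n + 1) / (n - 1) * (a⁻¹ - a) := by rw [h1, h2]; ring
    have : (n : ℝ) - 1 ≠ 0 := by linarith
    have : l ≠ 0 := by linarith
    field_simp at h3
    linear_combination h3
  obtain ⟨y, hy, hs⟩ := aux_sum_nu_gen n ρ T N a l ha hn1 ha0 (ha ▸ aux_alt ρ T hρ hT N hN)
    hl1 hq hD
  rw [← hs, nuN, aux_nuN n ρ T hT, aux_inv _ (aux_unit_nu n ρ T hρ hT N hN) y 1 hy]

lemma aux_cost (n : ℕ) (hn : 2 ≤ n) (ρ T : ℝ) (hρ : 0 < ρ) (hT : 0 < T) (N : ℕ) (hN : 0 < N)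
    (x : Fin n → ℝ) (xb : ℝ) (hxb : xb = (∑ j, x j) / (n : ℝ)) (i : Fin n)
    (hS : ∑ k, nuN n N ρ T 0 k ≠ 0) :
    costN n N ρ T 0 x i = n * xb ^ 2 * (1 / ∑ k, nuN n N ρ T 0 k) / (n + 1) +
      n * xb * (x i - xb) * (1 / ∑ k, omN N ρ T 0 k) := by
  have hn0 : (n : ℝ) ≠ 0 := by positivity
  have hv : ((n : ℝ) • GamT ρ (egrid T N) + (GamT ρ (egrid T N))ᵀ).mulVec (vN n N ρ T 0)
      = (1 / ∑ k, nuN n N ρ T 0 k) • 1 := by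
    rw [vN, Matrix.mulVec_smul]
    congr 1
    rw [nuN, aux_nuN n ρ T hT, aux_inv' _ (aux_unit_nu n ρ T hρ hT N hN)]
  have hw : (GamT ρ (egrid T N))ᵀ.mulVec (wN N ρ T 0) = (1 / ∑ k, omN N ρ T 0 k) • 1 := by
    rw [wN, Matrix.mulVec_smul]
    congr 1
    rw [omN, aux_Gam ρ T hT, add_sub_cancel_left, aux_inv' _ (aux_unit_om ρ T hρ hT N hN)]
  have hs : ∑ k, vN n N ρ T 0 k = 1 := by
    simp only [vN, Pi.smul_apply, smul_eq_mul]
    rw [← mul_sum]; field_simp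
  rw [← aux_alg (GamT ρ (egrid T N)) _ _ n _ _ xb (x i - xb) (by positivity) hv hs hw]
  have hxi : ∀ j, xiN n N ρ T 0 x j = xb • vN n N ρ T 0 + (x j - xb) • wN N ρ T 0 := by
    intro j; rw [xiN, hxb]
  have hsum : ∑ j ∈ Finset.univ.erase i, xiN n N ρ T 0 x j
      = (((n : ℝ) - 1) * xb) • vN n N ρ T 0 - (x i - xb) • wN N ρ T 0 := by
    have h1 : ∑ j, xiN n N ρ T 0 x j = ((n : ℝ) * xb) • vN n N ρ T 0 := by
      simp only [hxi]
      rw [sum_add_distrib, ← sum_smul, ← sum_smul, sum_sub_distrib]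
      have : ∑ j, x j = n * xb := by rw [hxb]; field_simp
      simp [this]
    rw [← add_sum_erase _ _ (mem_univ i), hxi i] at h1
    rw [eq_sub_of_add_eq' h1]
    module
  rw [costN, hsum, hxi, aux_Gam ρ T hT]

lemma aux_u (y : ℝ) (hy : 0 < y) :
    Tendsto (fun N : ℕ => y / (N : ℝ)) atTop (nhdsWithin 0 {0}ᶜ) := by
  rw [tendsto_nhdsWithin_iff]
  refine ⟨tendsto_const_div_atTop_nhds_zero_nat y, ?_⟩
  filter_upwards [eventually_gt_atTop 0] with N hN
  have : (0 : ℝ) < N := by exact_mod_cast hN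
  have : 0 < y / N := by positivity
  simpa using this.ne'

lemma aux_slope (g : ℝ → ℝ) (d y : ℝ) (hy : 0 < y) (hg : HasDerivAt g d 0) (h0 : g 0 = 0) :
    Tendsto (fun N : ℕ => g (y / N) / (y / N)) atTop (nhds d) := by
  have h := (hasDerivAt_iff_tendsto_slope.1 hg).comp (aux_u y hy)
  refine h.congr ?_
  intro N
  simp only [Function.comp, slope_def_field, h0, sub_zero]

lemma aux_phi (κ : ℝ) : HasDerivAt (fun u => Real.arsinh (κ * Real.sinh u)) κ 0 := by
  have h := ((Real.hasDerivAt_sinh 0).const_mul κ).arsinh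
  simpa using h

lemma aux_alpha (ρ T : ℝ) (hy : 0 < ρ * T) :
    Tendsto (fun N : ℕ => (1 - aN ρ T N) / (ρ * T / N)) atTop (nhds 1) := by
  have h : HasDerivAt (fun u : ℝ => 1 - Real.exp (-u)) 1 0 := by
    have := ((hasDerivAt_id (0 : ℝ)).neg.exp).const_sub 1
    simpa using this
  exact aux_slope _ 1 (ρ * T) hy h (by simp)

lemma aux_beta (n ρ T : ℝ) (hy : 0 < ρ * T) :
    Tendsto (fun N : ℕ => (lN n ρ T N - 1) / (ρ * T / N)) atTop (nhds ((n + 1) / (n - 1))) := by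
  have h : HasDerivAt (fun u : ℝ => Real.exp (Real.arsinh ((n + 1) / (n - 1) * Real.sinh u)) - 1)
      ((n + 1) / (n - 1)) 0 := by
    have := ((aux_phi ((n + 1) / (n - 1))).exp).sub_const 1
    simpa using this
  exact aux_slope _ _ (ρ * T) hy h (by simp)

lemma aux_u0 (y : ℝ) : Tendsto (fun N : ℕ => y / (N : ℝ)) atTop (nhds 0) :=
  tendsto_const_div_atTop_nhds_zero_nat y

lemma aux_alim (ρ T : ℝ) : Tendsto (fun N : ℕ => aN ρ T N) atTop (nhds 1) := by
  have : Continuous (fun u : ℝ => Real.exp (-u)) := by fun_prop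
  have h := (this.tendsto 0).comp (aux_u0 (ρ * T))
  simp only [neg_zero, Real.sinh_zero, mul_zero, Real.arsinh_zero, Real.exp_zero] at h
  exact h

lemma aux_llim (n ρ T : ℝ) : Tendsto (fun N : ℕ => lN n ρ T N) atTop (nhds 1) := by
  have : Continuous (fun u : ℝ => Real.exp (Real.arsinh ((n + 1) / (n - 1) * Real.sinh u))) := by
    have := Real.continuous_arsinh
    have := Real.continuous_sinh
    fun_prop
  have h := (this.tendsto 0).comp (aux_u0 (ρ * T))
  simp only [neg_zero, Real.sinh_zero, mul_zero, Real.arsinh_zero, Real.exp_zero] at h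
  exact h

lemma aux_Plim (n ρ T : ℝ) (hy : 0 < ρ * T) :
    Tendsto (fun N : ℕ => lN n ρ T N ^ (N + 1)) atTop
      (nhds (Real.exp (ρ * T * ((n + 1) / (n - 1))))) := by
  have h1 := aux_slope _ _ (ρ * T) hy (aux_phi ((n + 1) / (n - 1))) (by simp)
  have h2 : Tendsto (fun N : ℕ => ρ * T + ρ * T / (N : ℝ)) atTop (nhds (ρ * T)) := by
    simpa using (aux_u0 (ρ * T)).const_add (ρ * T)
  have h3 := (Real.continuous_exp.tendsto _).comp (h2.mul h1)
  refine h3.congr' ?_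
  filter_upwards [eventually_gt_atTop 0] with N hN
  have : (N : ℝ) ≠ 0 := by positivity
  simp only [Function.comp, lN]
  rw [← Real.exp_nat_mul]
  congr 1
  have := hy.ne'
  push_cast
  generalize Real.arsinh ((n + 1) / (n - 1) * Real.sinh (ρ * T / N)) = F
  generalize ρ * T = y at *
  field_simp

lemma aux_aPlim (ρ T : ℝ) :
    Tendsto (fun N : ℕ => aN ρ T N ^ (N + 1)) atTop (nhds (Real.exp (-(ρ * T)))) := by
  have h2 : Tendsto (fun N : ℕ => -(ρ * T + ρ * T / (N : ℝ))) atTop (nhds (-(ρ * T))) := by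
    simpa using ((aux_u0 (ρ * T)).const_add (ρ * T)).neg
  have h3 := (Real.continuous_exp.tendsto _).comp h2
  refine h3.congr' ?_
  filter_upwards [eventually_gt_atTop 0] with N hN
  have : (N : ℝ) ≠ 0 := by positivity
  simp only [Function.comp, aN]
  rw [← Real.exp_nat_mul]
  congr 1
  push_cast
  field_simp

lemma aux_mlim (ρ T : ℝ) (hy : 0 < ρ * T) :
    Tendsto (fun N : ℕ => ((N : ℝ) + 1) * (1 - aN ρ T N)) atTop (nhds (ρ * T)) := by
  have h2 : Tendsto (fun N : ℕ => ρ * T + ρ * T / (N : ℝ)) atTop (nhds (ρ * T)) := by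
    simpa using (aux_u0 (ρ * T)).const_add (ρ * T)
  have h := h2.mul (aux_alpha ρ T hy)
  rw [mul_one] at h
  refine h.congr' ?_
  filter_upwards [eventually_gt_atTop 0] with N hN
  have : (N : ℝ) ≠ 0 := by positivity
  have := hy.ne'
  generalize ρ * T = y at *
  field_simp

lemma aux_omlim (ρ T : ℝ) (hρ : 0 < ρ) (hT : 0 < T) (s : ℝ) :
    Tendsto (fun N : ℕ => ((N : ℝ) + 1) * (2 * (1 - aN ρ T N) / (1 + aN ρ T N)) +
      4 * aN ρ T N * (1 - s * aN ρ T N ^ (N + 1)) / (1 + aN ρ T N) ^ 2) atTop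
      (nhds (ρ * T + 1 - s * Real.exp (-(ρ * T)))) := by
  have ha := aux_alim ρ T
  have h1 : Tendsto (fun N : ℕ => 1 + aN ρ T N) atTop (nhds 2) := by
    have := ha.const_add 1; norm_num at this; exact this
  have h2 := (((aux_mlim ρ T (by positivity)).mul_const 2).div h1 (by norm_num)).add
    (((ha.const_mul 4).mul (((aux_aPlim ρ T).const_mul s).const_sub 1)).div (h1.pow 2) (by norm_num))
  convert h2 using 2
  · simp only [Pi.div_apply]; ring
  · ring

lemma aux_E (n y : ℝ) (hn : 2 ≤ n) (hy : 0 < y) : 1 < Real.exp (y * ((n + 1) / (n - 1))) := by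
  rw [Real.one_lt_exp_iff]
  have : 0 < n - 1 := by linarith
  positivity

lemma aux_DE (n E s : ℝ) (hn : 2 ≤ n) (hE : 1 < E) (hs : s ≤ 1) : 0 < n * E ^ 2 - s := by
  nlinarith

lemma aux_DEne (n E s : ℝ) (hn : 2 ≤ n) (hE : 1 < E) (hs : s ≤ 1) :
    DF ((n - 1) / (2 * n)) (-(n - 1) / 2) (1 / 2) (1 / 2) E s ≠ 0 := by
  have h := aux_DE n E s hn hE hs
  have : DF ((n - 1) / (2 * n)) (-(n - 1) / 2) (1 / 2) (1 / 2) E s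
      = -((n - 1) * (n * E ^ 2 - s) / (4 * n * E)) := by
    unfold DF
    have : n ≠ 0 := by linarith
    have : E ≠ 0 := by linarith
    field_simp; ring
  rw [this, neg_ne_zero]
  have : 0 < n - 1 := by linarith
  have : 0 < n := by linarith
  have : 0 < E := by linarith
  positivity

def dF (n y E s : ℝ) : ℝ :=
  n * E ^ 2 * ((n + 1) * y + n + 3) - (n - 1) * (s * n + 1) * E - s * ((n + 1) * y + 3 * n + 1)

lemma aux_SE (n y E s : ℝ) (hn : 2 ≤ n) (hE : 1 < E) (hs : s ≤ 1) :
    SF y (1 / (n + 1)) ((n - 1) / (2 * n)) (-(n - 1) / 2) (1 / 2) (1 / 2) E s ((n - 1) / (n + 1)) 2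
      = dF n y E s / ((n + 1) ^ 2 * (n * E ^ 2 - s)) := by
  have h := aux_DE n E s hn hE hs
  have hD : DF ((n - 1) / (2 * n)) (-(n - 1) / 2) (1 / 2) (1 / 2) E s
      = -((n - 1) * (n * E ^ 2 - s) / (4 * n * E)) := by
    unfold DF
    have : n ≠ 0 := by linarith
    have : E ≠ 0 := by linarith
    field_simp; ring
  have : n - 1 ≠ 0 := by linarith
  have : n ≠ 0 := by linarith
  have : n + 1 ≠ 0 := by linarith
  have : E ≠ 0 := by linarith
  have := h.ne'
  rw [SF, AF, BF, hD, dF]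
  field_simp
  ring

lemma aux_dF (n y E s : ℝ) (hn : 2 ≤ n) (hy : 0 < y) (hE : 1 < E) (hs : s = 1 ∨ s = -1) :
    0 < dF n y E s := by
  have h1 : 0 < (n + 1) * y := by positivity
  rcases hs with rfl | rfl
  · have e : dF n y E 1 = (n * E ^ 2 - 1) * ((n + 1) * y) + (E - 1) * (n * (n + 3) * E + 3 * n + 1) := by
      unfold dF; ring
    rw [e]
    have := aux_DE n E 1 hn hE le_rfl
    have : 0 < E - 1 := by linarith
    positivity
  · have e : dF n y E (-1) = n * E ^ 2 * ((n + 1) * y + n + 3) + (n - 1) ^ 2 * E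
        + ((n + 1) * y + 3 * n + 1) := by
      unfold dF; ring
    rw [e]
    positivity

lemma aux_lims (n ρ T : ℝ) (hn : 2 ≤ n) (hy : 0 < ρ * T) (s : ℝ) (hs : s ≤ 1) :
    Tendsto (fun N : ℕ => DF (pF (aN ρ T N) (lN n ρ T N)) (qF (aN ρ T N) (lN n ρ T N))
      (rF (aN ρ T N) (lN n ρ T N)) (rF2 (aN ρ T N) (lN n ρ T N)) (lN n ρ T N ^ (N + 1)) s) atTop
      (nhds (DF ((n - 1) / (2 * n)) (-(n - 1) / 2) (1 / 2) (1 / 2)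
        (Real.exp (ρ * T * ((n + 1) / (n - 1)))) s)) ∧
    Tendsto (fun N : ℕ => SF ((N + 1) * (1 - aN ρ T N)) (cF n (aN ρ T N))
      (pF (aN ρ T N) (lN n ρ T N)) (qF (aN ρ T N) (lN n ρ T N))
      (rF (aN ρ T N) (lN n ρ T N)) (rF2 (aN ρ T N) (lN n ρ T N)) (lN n ρ T N ^ (N + 1)) s
      ((1 - aN ρ T N) / (lN n ρ T N - 1)) (1 + (lN n ρ T N)⁻¹)) atTop
      (nhds (SF (ρ * T) (1 / (n + 1)) ((n - 1) / (2 * n)) (-(n - 1) / 2) (1 / 2) (1 / 2)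
        (Real.exp (ρ * T * ((n + 1) / (n - 1)))) s ((n - 1) / (n + 1)) 2)) := by
  have hn1 : n - 1 ≠ 0 := by linarith
  have hn0 : n ≠ 0 := by linarith
  have hn2 : n + 1 ≠ 0 := by linarith
  have ha := aux_alim ρ T
  have hl := aux_llim n ρ T
  have hP := aux_Plim n ρ T hy
  have hal := aux_alpha ρ T hy
  have hbe := aux_beta n ρ T hy
  have hm := aux_mlim ρ T hy
  have hE := aux_E n (ρ * T) hn hy
  set E := Real.exp (ρ * T * ((n + 1) / (n - 1))) with hEd
  have hE0 : E ≠ 0 := by linarith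
  have hc : Tendsto (fun N : ℕ => cF n (aN ρ T N)) atTop (nhds (1 / (n + 1))) := by
    have := (tendsto_const_nhds (x := (2 : ℝ))).div ((ha.const_add 1).const_mul (n + 1))
      (mul_ne_zero hn2 (by norm_num))
    rw [show 1 / (n + 1) = 2 / ((n + 1) * (1 + 1)) by field_simp; norm_num]
    exact this
  have hr : Tendsto (fun N : ℕ => rF (aN ρ T N) (lN n ρ T N)) atTop (nhds (1 / 2)) := by
    have := hl.div ((ha.mul hl).const_add 1) (by norm_num)
    rw [show (1 / 2 : ℝ) = 1 / (1 + 1 * 1) by norm_num]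
    exact this
  have hr2 : Tendsto (fun N : ℕ => rF2 (aN ρ T N) (lN n ρ T N)) atTop (nhds (1 / 2)) := by
    have := hl.div (hl.add ha) (by norm_num)
    rw [show (1 / 2 : ℝ) = 1 / (1 + 1) by norm_num]
    exact this
  have hu : ∀ᶠ N : ℕ in atTop, ρ * T / (N : ℝ) ≠ 0 := by
    filter_upwards [eventually_gt_atTop 0] with N hN
    have : (N : ℝ) ≠ 0 := by positivity
    exact div_ne_zero hy.ne' this
  have hp : Tendsto (fun N : ℕ => pF (aN ρ T N) (lN n ρ T N)) atTop
      (nhds ((n - 1) / (2 * n))) := by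
    have hne : (n + 1) / (n - 1) + 1 = 2 * n / (n - 1) := by field_simp; ring
    have := hal.div (hbe.add hal) (by rw [hne]; positivity)
    rw [hne, one_div_div] at this
    refine this.congr' ?_
    filter_upwards [hu] with N hN
    simp only [Pi.div_apply, pF]
    rw [← add_div, div_div_div_cancel_right₀ hN]
    congr 1; ring
  have hq : Tendsto (fun N : ℕ => qF (aN ρ T N) (lN n ρ T N)) atTop
      (nhds (-(n - 1) / 2)) := by
    have hne : 1 - 1 * ((n + 1) / (n - 1)) = -2 / (n - 1) := by field_simp; ring
    have := hal.div (hal.sub (ha.mul hbe)) (by rw [hne]; exact div_ne_zero (by norm_num) hn1)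
    rw [hne, one_div_div] at this
    rw [show -(n - 1) / 2 = (n - 1) / -2 by ring]
    refine this.congr' ?_
    filter_upwards [hu] with N hN
    simp only [Pi.div_apply, qF]
    rw [← mul_div_assoc, ← sub_div, div_div_div_cancel_right₀ hN]
    congr 1; ring
  have he : Tendsto (fun N : ℕ => (1 - aN ρ T N) / (lN n ρ T N - 1)) atTop
      (nhds ((n - 1) / (n + 1))) := by
    have := hal.div hbe (div_ne_zero hn2 hn1)
    rw [one_div_div] at this
    refine this.congr' ?_
    filter_upwards [hu] with N hN
    simp only [Pi.div_apply]
    rw [div_div_div_cancel_right₀ hN]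
  have hf : Tendsto (fun N : ℕ => 1 + (lN n ρ T N)⁻¹) atTop (nhds 2) := by
    have := (hl.inv₀ one_ne_zero).const_add 1
    convert this using 2
    norm_num
  have hsP := (hP.inv₀ hE0).const_mul s
  have hD := ((hp.mul hsP).mul hr2).add ((hr.mul hP).mul hq)
  refine ⟨hD, ?_⟩
  have hDne := aux_DEne n E s hn hE hs
  have hA := (((hc.mul hsP).mul hr2).neg.sub (hr.mul hc)).div hD hDne
  have hB := ((hp.mul hc).neg.add ((hc.mul hP).mul hq)).div hD hDne
  exact ((hm.mul hc).add ((hA.mul he).mul (hP.sub_const 1))).add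
    ((hB.mul (hsP.const_sub 1)).div hf two_ne_zero)

lemma aux_main (n : ℕ) (hn : 2 ≤ n) (ρ T : ℝ) (hρ : 0 < ρ) (hT : 0 < T)
    (x : Fin n → ℝ) (xb : ℝ) (hxb : xb = (∑ j, x j) / (n : ℝ)) (i : Fin n)
    (g : ℕ → ℕ) (hg : Tendsto g atTop atTop) (s : ℝ) (hs : s = 1 ∨ s = -1)
    (hgs : ∀ N, (-1 : ℝ) ^ (g N + 1) = s)
    (hne : ρ * T + 1 - s * Real.exp (-(ρ * T)) ≠ 0) (E : ℝ)
    (hE : E = Real.exp (ρ * T * (((n : ℝ) + 1) / (n - 1)))) :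
    Tendsto (fun N : ℕ => costN n (g N) ρ T 0 x i) atTop (nhds
      (n * xb ^ 2 * (1 / (dF n (ρ * T) E s / (((n : ℝ) + 1) ^ 2 * (n * E ^ 2 - s)))) / (n + 1) +
      n * xb * (x i - xb) * (1 / (ρ * T + 1 - s * Real.exp (-(ρ * T)))))) := by
  have hn' : (2 : ℝ) ≤ n := by exact_mod_cast hn
  have hy : 0 < ρ * T := by positivity
  have hs1 : s ≤ 1 := by rcases hs with rfl | rfl <;> norm_num
  have hE1 := aux_E n (ρ * T) hn' hy
  obtain ⟨hD, hS⟩ := aux_lims n ρ T hn' hy s hs1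
  rw [← hE] at hD hS hE1
  rw [aux_SE n (ρ * T) E s hn' hE1 hs1] at hS
  have hdpos := aux_dF n (ρ * T) E s hn' hy hE1 hs
  have hDE := aux_DE n E s hn' hE1 hs1
  have hSne : dF n (ρ * T) E s / (((n : ℝ) + 1) ^ 2 * (n * E ^ 2 - s)) ≠ 0 := by positivity
  have hDev := hg.eventually (hD.eventually_ne (aux_DEne n E s hn' hE1 hs1))
  have hSev := hg.eventually (hS.eventually_ne hSne)
  have hgpos := hg.eventually (eventually_gt_atTop 0)
  have hom := (aux_omlim ρ T hρ hT s).comp hg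
  have hS' := hS.comp hg
  have h1 := (((tendsto_const_nhds (x := (1 : ℝ))).div hS' hSne).const_mul
    ((n : ℝ) * xb ^ 2)).div_const ((n : ℝ) + 1)
  have h2 := ((tendsto_const_nhds (x := (1 : ℝ))).div hom hne).const_mul
    ((n : ℝ) * xb * (x i - xb))
  refine (h1.add h2).congr' ?_
  filter_upwards [hDev, hSev, hgpos] with N hN1 hN2 hN3
  have e1 := aux_sum_nu n hn ρ T hρ hT (g N) hN3 _ _ rfl rfl (by rw [hgs N]; exact hN1)
  have e2 := aux_sum_om ρ T hρ hT (g N) hN3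
  rw [hgs N] at e1 e2
  rw [aux_cost n hn ρ T hρ hT (g N) hN3 x xb hxb i (by rw [e1]; exact hN2), e1, e2]
  rfl

lemma aux_fin (k d w m t : ℝ) (hm : m ≠ 0) (ht : t = m * w) :
    k * t / d = k * (1 / (d / (m ^ 2 * w))) / m := by
  rw [one_div_div, ht]
  field_simp

/-- Divergence of the equilibrium execution costs for `θ = 0`: the even and odd
subsequences converge to two different limits. -/
theorem stmt17 (n : ℕ) (hn : 2 ≤ n) (ρ T : ℝ) (hρ : 0 < ρ) (hT : 0 < T)
    (x : Fin n → ℝ) (xb : ℝ) (hxb : xb = (∑ j, x j) / (n : ℝ)) :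
    ∀ i : Fin n,
      Tendsto (fun N : ℕ => costN n (2 * N) ρ T 0 x i) atTop
        (nhds
          ((n : ℝ) * xb ^ 2 *
              (((n : ℝ) + 1) * (n : ℝ) *
                  Real.exp (2 * ρ * T * ((n : ℝ) + 1) / ((n : ℝ) - 1))
                + (n : ℝ) + 1) / frakd1 n ρ T
            + (n : ℝ) * xb * (x i - xb) / (Real.exp (-(ρ * T)) + ρ * T + 1))) ∧
      Tendsto (fun N : ℕ => costN n (2 * N + 1) ρ T 0 x i) atTop
        (nhds
          ((n : ℝ) * xb ^ 2 *
              (((n : ℝ) + 1) * (n : ℝ) *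
                  Real.exp (2 * ρ * T * ((n : ℝ) + 1) / ((n : ℝ) - 1))
                - (n : ℝ) - 1) / frakd2 n ρ T
            + (n : ℝ) * xb * (x i - xb) / (ρ * T + 1 - Real.exp (-(ρ * T))))) := by
  intro i
  have hn' : (2 : ℝ) ≤ n := by exact_mod_cast hn
  have hy : 0 < ρ * T := by positivity
  have hn1 : (n : ℝ) - 1 ≠ 0 := by linarith
  have hE1 := aux_E n (ρ * T) hn' hy
  have hex : Real.exp (-(ρ * T)) < 1 := by rw [Real.exp_lt_one_iff]; linarith
  have hex0 := Real.exp_pos (-(ρ * T))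
  have hEE : Real.exp (2 * ρ * T * ((n : ℝ) + 1) / ((n : ℝ) - 1))
      = Real.exp (ρ * T * (((n : ℝ) + 1) / (n - 1))) ^ 2 := by
    rw [← Real.exp_nat_mul]; congr 1; push_cast; ring
  have hE' : Real.exp (ρ * T * ((n : ℝ) + 1) / ((n : ℝ) - 1))
      = Real.exp (ρ * T * (((n : ℝ) + 1) / (n - 1))) := by
    congr 1; ring
  have hd1 : frakd1 n ρ T = dF n (ρ * T) (Real.exp (ρ * T * (((n : ℝ) + 1) / (n - 1)))) (-1) := by
    rw [frakd1, hEE, hE', dF]; ring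
  have hd2 : frakd2 n ρ T = dF n (ρ * T) (Real.exp (ρ * T * (((n : ℝ) + 1) / (n - 1)))) 1 := by
    rw [frakd2, hEE, hE', dF]; ring
  rw [hEE, hd1, hd2]
  set E := Real.exp (ρ * T * (((n : ℝ) + 1) / (n - 1))) with hE
  constructor
  · have h := aux_main n hn ρ T hρ hT x xb hxb i (fun N => 2 * N)
      (tendsto_atTop_mono (fun N => by simp only [id]; omega) tendsto_id) (-1) (Or.inr rfl)
      (fun N => by rw [pow_succ, pow_mul]; norm_num) (by linarith) E hE
    convert h using 2
    congr 1
    · exact aux_fin _ _ _ _ _ (by positivity) (by ring)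
    · rw [mul_one_div]; congr 1; ring
  · have h := aux_main n hn ρ T hρ hT x xb hxb i (fun N => 2 * N + 1)
      (tendsto_atTop_mono (fun N => by simp only [id]; omega) tendsto_id) 1 (Or.inl rfl)
      (fun N => by rw [pow_succ, pow_succ, pow_mul]; norm_num) (by linarith) E hE
    convert h using 2
    congr 1
    · exact aux_fin _ _ _ _ _ (by positivity) (by ring)
    · rw [mul_one_div]; congr 1; ring
end
end
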